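/- arXiv:1701.08562 — 2 statements merged into one kernel-verified Lean document; each statement's English description precedes it below -/
import Mathlib

section
/- For every triangle T ⊂ ℝ² there exist an infinite sequence of points x₀, x₁, x₂, … in T and a constant C > 0 such that for every twice continuously differentiable function f : T → ℝ with ‖f‖_{C²(T)} ≤ 1 the following hold: (i) for every integer N ≥ 2, |(1/N)·∑_{n=0}^{N−1} f(xₙ) − (1/|T|)·∫_T f(x) dx| ≤ C·(log₂ N)³/N, and (ii) for every positive integer m, |(1/2^m)·∑_{n=0}^{2^m−1} f(xₙ) − (1/|T|)·∫_T f(x) dx| ≤ C·m²/2^m. -/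
open MeasureTheory

noncomputable section

/-- The two-element field. -/
abbrev F2 : Type := ZMod 2

/-- Points of the plane. -/
abbrev Pt : Type := EuclideanSpace ℝ (Fin 2)

/-- The (closed) triangle with vertices `A`, `B`, `C`. -/
def tri (A B C : Pt) : Set Pt :=
  {x | ∃ w1 w2 w3 : ℝ, 0 ≤ w1 ∧ 0 ≤ w2 ∧ 0 ≤ w3 ∧ w1 + w2 + w3 = 1 ∧
    x = w1 • A + w2 • B + w3 • C}

/-- One step of the recursive partitioning, acting on vertex triples `(A,B,C)`. -/
def subV (v : Pt × Pt × Pt) (ξ : F2 × F2) : Pt × Pt × Pt :=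
  if ξ = (1, 0) then (v.1, (2:ℝ)⁻¹ • (v.1 + v.2.1), (2:ℝ)⁻¹ • (v.1 + v.2.2))
  else if ξ = (0, 1) then ((2:ℝ)⁻¹ • (v.2.1 + v.1), v.2.1, (2:ℝ)⁻¹ • (v.2.1 + v.2.2))
  else if ξ = (1, 1) then ((2:ℝ)⁻¹ • (v.2.2 + v.1), (2:ℝ)⁻¹ • (v.2.2 + v.2.1), v.2.2)
  else ((2:ℝ)⁻¹ • (v.2.1 + v.2.2), (2:ℝ)⁻¹ • (v.2.2 + v.1), (2:ℝ)⁻¹ • (v.1 + v.2.1))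

/-- Iterated partitioning along a list of pairs of bits (the rows of `X`). -/
def vIter (v : Pt × Pt × Pt) (l : List (F2 × F2)) : Pt × Pt × Pt := l.foldl subV v

/-- The subtriangle `T^{(n)}(X)` where `l` is the list of rows of `X`. -/
def subTri (v : Pt × Pt × Pt) (l : List (F2 × F2)) : Set Pt :=
  tri (vIter v l).1 (vIter v l).2.1 (vIter v l).2.2

/-- The centre `φ^{(n)}(X)` of the subtriangle `T^{(n)}(X)`. -/
def ctr (v : Pt × Pt × Pt) (l : List (F2 × F2)) : Pt :=
  (3:ℝ)⁻¹ • ((vIter v l).1 + (vIter v l).2.1 + (vIter v l).2.2)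

/-- The sign `η_i(X)` (with `i` 1-indexed, `1 ≤ i ≤ n+1`). -/
def eta {n : ℕ} (X : Fin n → F2 × F2) (i : ℕ) : ℝ :=
  (-1 : ℝ) ^ (Finset.univ.filter fun a : Fin n => (a : ℕ) + 1 < i ∧ X a = (0, 0)).card

/-- First coordinate direction. -/
def dir1 : Pt := EuclideanSpace.single 0 1

/-- Second coordinate direction. -/
def dir2 : Pt := EuclideanSpace.single 1 1

/-- Partial derivative (within `T`) of `f` in the direction `v`. -/
def pdW (T : Set Pt) (v : Pt) (f : Pt → ℝ) : Pt → ℝ := fun x => fderivWithin ℝ f T x v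

/-- Sup of `|g|` over `T`. -/
def supAbs (T : Set Pt) (g : Pt → ℝ) : ℝ := ⨆ x ∈ T, |g x|

/-- The norm `‖f‖_{C²(T)}`: the maximum over all partial derivatives of order at most 2
of the sup norm on `T`. -/
def c2Norm (T : Set Pt) (f : Pt → ℝ) : ℝ :=
  max (supAbs T f)
    (max (max (supAbs T (pdW T dir1 f)) (supAbs T (pdW T dir2 f)))
      (max (supAbs T (pdW T dir1 (pdW T dir1 f)))
        (max (supAbs T (pdW T dir2 (pdW T dir1 f)))
          (supAbs T (pdW T dir2 (pdW T dir2 f))))))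

/-- The `n`-th discretized function `F_n` of `f` (with `X` given by its rows). -/
def discF (v : Pt × Pt × Pt) {n : ℕ} (f : Pt → ℝ) (X : Fin n → F2 × F2) : ℝ :=
  (volume (subTri v (List.ofFn X))).toReal⁻¹ * ∫ y in subTri v (List.ofFn X), f y

/-- The `l`-th dyadic digit of `h`. -/
def digit (h l : ℕ) : F2 := if Nat.testBit h l then 1 else 0

/-- The weight `μ₁(k)` of a column vector: the largest (1-indexed) position of a
nonzero entry, and `0` for the zero vector. -/
def mu1 {n : ℕ} (k : Fin n → F2) : ℕ :=
  (Finset.univ.filter fun i : Fin n => k i ≠ 0).sup fun i => (i : ℕ) + 1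

/-- The weight `v(K) = max (μ₁(k₁), μ₁(k₂))` of `K` (given by its rows). -/
def vK {n : ℕ} (K : Fin n → F2 × F2) : ℕ :=
  max (mu1 fun i => (K i).1) (mu1 fun i => (K i).2)

/-- Entry `(i, j)` (0-indexed row `i`) of the point `X(h)` of the digital sequence with
generating matrices `Cm 0`, `Cm 1` (0-indexed). -/
def Xent (Cm : Fin 2 → ℕ → ℕ → F2) (h i : ℕ) (j : Fin 2) : F2 :=
  ∑ l ∈ Finset.range (h + 1), Cm j i l * digit h l

/-- Row `i` (0-indexed) of the point `X(h)` of the digital sequence. -/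
def XrowS (Cm : Fin 2 → ℕ → ℕ → F2) (h i : ℕ) : F2 × F2 :=
  (Xent Cm h i 0, Xent Cm h i 1)

/-- `ν(h)`: the number of initial rows of `X(h)` after which all rows vanish. -/
def nuF (Cm : Fin 2 → ℕ → ℕ → F2) (h : ℕ) : ℕ :=
  sInf {q | ∀ i, q ≤ i → XrowS Cm h i = (0, 0)}

/-- The `h`-th point of the sequence `S_T` in the triangle with vertex triple `v`. -/
def seqPt (v : Pt × Pt × Pt) (Cm : Fin 2 → ℕ → ℕ → F2) (h : ℕ) : Pt :=
  ctr v (List.ofFn fun i : Fin (nuF Cm h) => XrowS Cm h (i : ℕ))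

/-- Row `i` of the digital-net point `X(h)` for generating matrices `C1 C2 ∈ 𝔽₂^{n×m}`. -/
def XnetRow {n m : ℕ} (C1 C2 : Matrix (Fin n) (Fin m) F2) (h : ℕ) (i : Fin n) : F2 × F2 :=
  (∑ l : Fin m, C1 i l * digit h (l : ℕ), ∑ l : Fin m, C2 i l * digit h (l : ℕ))

/-- The Walsh function `wal_K(X)` (for `K`, `X` given by their rows). -/
def walR {n : ℕ} (K X : Fin n → F2 × F2) : ℝ :=
  (-1 : ℝ) ^ (∑ i : Fin n, ((K i).1 * (X i).1 + (K i).2 * (X i).2)).val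

/-- The `K`-th Walsh coefficient of `F : 𝔽₂^{n×2} → ℝ`. -/
def fhat {n : ℕ} (F : (Fin n → F2 × F2) → ℝ) (K : Fin n → F2 × F2) : ℝ :=
  ((4:ℝ) ^ n)⁻¹ * ∑ X : Fin n → F2 × F2, F X * walR K X

/-- The vector `τ(κ, κ')`. -/
def tau (e : F2 × F2 → Pt) (κ κ' : F2 × F2) : Pt :=
  if κ' ≠ (0, 0) ∧ κ' ≠ κ then e (κ + κ') - e κ' else e (κ + κ') + e κ'

/-- The point shift `y ⊕_i κ` on `T^{(n)}(X)` (with `i : Fin n` the 0-indexed row,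
corresponding to the 1-indexed row `i+1` of the paper). -/
def ptShift (e : F2 × F2 → Pt) {n : ℕ} (X : Fin n → F2 × F2) (i : Fin n)
    (κ : F2 × F2) (y : Pt) : Pt :=
  if X i ≠ (0, 0) ∧ X i ≠ κ then
    y + (eta X ((i : ℕ) + 1) / 2 ^ ((i : ℕ) + 1)) • tau e κ (X i)
  else
    (2:ℝ) • ctr (e (1, 0), e (0, 1), e (1, 1)) ((List.ofFn X).take (i : ℕ)) - y +
      (eta X ((i : ℕ) + 1) / 2 ^ ((i : ℕ) + 1)) • tau e κ (X i)

/-- The map `σ : 𝔽₂² → 𝔽₂²`. -/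
def sigF : F2 × F2 → F2 × F2 := fun κ =>
  if κ = (0, 0) then (1, 1) else if κ = (1, 1) then (0, 1) else κ

/-- The two-element set `P(κ) = {p₁(κ), p₂(κ)}`. -/
def pSet (κ : F2 × F2) : Finset (F2 × F2) :=
  if κ = (0, 0) then {(0, 0), (1, 1)} else if κ = (0, 1) then {(1, 1), (1, 0)}
  else if κ = (1, 0) then {(1, 1), (0, 1)} else {(1, 0), (1, 1)}

/-- The one-row Walsh function `wal_κ(ξ)`. -/
def walRow (κ ξ : F2 × F2) : ℝ := (-1 : ℝ) ^ ((κ.1 * ξ.1 + κ.2 * ξ.2 : F2)).val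

/-- The `i`-th dyadic difference `d_K^{(i)} F` (with `i : Fin n` 0-indexed, corresponding
to the 1-indexed index `i+1` of the paper). -/
def dd {n : ℕ} (K : Fin n → F2 × F2) (i : Fin n) (F : (Fin n → F2 × F2) → ℝ) :
    (Fin n → F2 × F2) → ℝ :=
  fun X => F (Function.update X i (X i + sigF (K i))) + walRow (K i) (sigF (K i)) * F X

/-- The subset `R_w(K) ⊆ 𝔽₂^{n×2}` (here `w : ℕ` is the 1-indexed paper index,
`0 ≤ w ≤ v(K)-1`). -/
def Rset {n : ℕ} (K : Fin n → F2 × F2) (w : ℕ) : Finset (Fin n → F2 × F2) :=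
  Finset.univ.filter fun X =>
    (∀ i : Fin n, w ≤ (i : ℕ) → (i : ℕ) + 1 < vK K → X i ∉ pSet (K i)) ∧
    (w = 0 ∨ ∃ j : Fin n, (j : ℕ) + 1 = w ∧ X j ∈ pSet (K j))

/-- The Walsh coefficient of `F` on the subset `R_w(K)`. -/
def rwHat {n : ℕ} (F : (Fin n → F2 × F2) → ℝ) (K : Fin n → F2 × F2) (w : ℕ) : ℝ :=
  ((4:ℝ) ^ n)⁻¹ * ∑ X ∈ Rset K w, F X * walR K X

/-- The two inverse branches of the tent map on `[0, 1]`. -/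
def tentInv (b : Bool) (x : ℝ) : ℝ := if b then 1 - x / 2 else x / 2

/-- The four inverse branches of the product of two tent maps on the unit square. -/
def tentBranch (b c : Bool) (p : ℝ × ℝ) : ℝ × ℝ := (tentInv b p.1, tentInv c p.2)

/-- The (unnormalised) transfer operator of the product of two tent maps. -/
def tentSum (F : ℝ × ℝ → ℝ) (p : ℝ × ℝ) : ℝ :=
  F (tentBranch false false p) + F (tentBranch true true p) +
    F (tentBranch false true p) + F (tentBranch true false p)

/-- The sequence in the unit square obtained by reading the base-4 digits of `n` as choices of
inverse branches of the product tent map. -/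
def tentPt (n : ℕ) : ℝ × ℝ :=
  if h : n = 0 then (0, 0)
  else tentBranch (decide (n % 2 = 1)) (decide (n / 2 % 2 = 1)) (tentPt (n / 4))
termination_by n
decreasing_by omega

/-- The unit square. -/
def unitSq : Set (ℝ × ℝ) := Set.Icc 0 1

/-- The part of the unit square below the diagonal. -/
def lowerHalf : Set (ℝ × ℝ) := {p | p ∈ unitSq ∧ p.2 ≤ p.1}

/-- The part of the unit square above the diagonal. -/
def upperHalf : Set (ℝ × ℝ) := {p | p ∈ unitSq ∧ p.1 ≤ p.2}

/-- `F` has central second differences bounded by `K ‖d‖²` along segments with endpoints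
in `S`. -/
def SecondDiffBound (S : Set (ℝ × ℝ)) (K : ℝ) (F : ℝ × ℝ → ℝ) : Prop :=
  ∀ c d, c + d ∈ S → c - d ∈ S → |F (c + d) + F (c - d) - 2 * F c| ≤ K * ‖d‖ ^ 2

/-- `F` is `L`-Lipschitz on the unit square and has second differences bounded by `K` on each
side of the diagonal. -/
structure FoldBound (L K : ℝ) (F : ℝ × ℝ → ℝ) : Prop where
  lip : ∀ p ∈ unitSq, ∀ q ∈ unitSq, |F p - F q| ≤ L * ‖p - q‖
  lower : SecondDiffBound lowerHalf K F
  upper : SecondDiffBound upperHalf K F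

lemma mem_unitSq {p : ℝ × ℝ} : p ∈ unitSq ↔ (0 ≤ p.1 ∧ p.1 ≤ 1) ∧ 0 ≤ p.2 ∧ p.2 ≤ 1 := by
  simp only [unitSq, Set.mem_Icc, Prod.le_def, Prod.fst_zero, Prod.snd_zero, Prod.fst_one,
    Prod.snd_one]
  tauto

lemma tentInv_mem (b : Bool) {x : ℝ} (hx : 0 ≤ x ∧ x ≤ 1) :
    0 ≤ tentInv b x ∧ tentInv b x ≤ 1 := by
  cases b <;> simp only [tentInv] <;> constructor <;> norm_num <;> linarith

lemma tentBranch_mem (b c : Bool) {p : ℝ × ℝ} (hp : p ∈ unitSq) : tentBranch b c p ∈ unitSq := by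
  rw [mem_unitSq] at hp ⊢
  exact ⟨tentInv_mem b hp.1, tentInv_mem c hp.2⟩

lemma tentBranch_false_true_mem {p : ℝ × ℝ} (hp : p ∈ unitSq) :
    tentBranch false true p ∈ upperHalf := by
  refine ⟨tentBranch_mem _ _ hp, ?_⟩
  rw [mem_unitSq] at hp
  simp only [tentBranch, tentInv]
  norm_num
  linarith

lemma tentBranch_true_false_mem {p : ℝ × ℝ} (hp : p ∈ unitSq) :
    tentBranch true false p ∈ lowerHalf := by
  refine ⟨tentBranch_mem _ _ hp, ?_⟩
  rw [mem_unitSq] at hp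
  simp only [tentBranch, tentInv]
  norm_num
  linarith

lemma tentInv_sub (b : Bool) (x y : ℝ) : |tentInv b x - tentInv b y| = |x - y| / 2 := by
  have h2 : |x - y| / 2 = |(x - y) / 2| := by rw [abs_div]; norm_num
  rw [h2]
  cases b
  · simp only [tentInv]; norm_num; ring_nf
  · rw [← abs_neg]; simp only [tentInv]; norm_num; ring_nf

lemma norm_tentBranch_sub (b c : Bool) (p q : ℝ × ℝ) :
    ‖tentBranch b c p - tentBranch b c q‖ = ‖p - q‖ / 2 := by
  simp only [Prod.norm_def, tentBranch, Prod.fst_sub, Prod.snd_sub, Real.norm_eq_abs, tentInv_sub]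
  exact max_div_div_right (by norm_num) _ _

lemma tentBranch_midpoint (b e : Bool) (c d : ℝ × ℝ) :
    tentBranch b e (c - d) =
      tentBranch b e c - (tentBranch b e (c + d) - tentBranch b e c) := by
  cases b <;> cases e <;> ext <;> simp [tentBranch, tentInv] <;> ring

lemma SecondDiffBound.comp_tentBranch {S S' : Set (ℝ × ℝ)} {K : ℝ} {F : ℝ × ℝ → ℝ}
    (hF : SecondDiffBound S K F) (b e : Bool) (hm : ∀ p ∈ S', tentBranch b e p ∈ S) :
    SecondDiffBound S' (K / 4) (fun p => F (tentBranch b e p)) := by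
  intro c d h1 h2
  have h := hF (tentBranch b e c) (tentBranch b e (c + d) - tentBranch b e c)
    (by simpa using hm _ h1) (by rw [← tentBranch_midpoint]; exact hm _ h2)
  rw [← tentBranch_midpoint, add_sub_cancel, norm_tentBranch_sub, add_sub_cancel_left] at h
  refine h.trans (le_of_eq ?_)
  ring

lemma iterate_tentSum_add (j : ℕ) (F G : ℝ × ℝ → ℝ) (p : ℝ × ℝ) :
    tentSum^[j] (fun q => F q + G q) p = tentSum^[j] F p + tentSum^[j] G p := by
  induction j generalizing F G with
  | zero => rfl
  | succ j ih =>
    simp only [Function.iterate_succ_apply]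
    rw [← ih]
    refine congrArg (fun G => tentSum^[j] G p) (funext fun q => ?_)
    simp only [tentSum]
    ring

lemma iterate_succ_tentSum (j : ℕ) (F : ℝ × ℝ → ℝ) (p : ℝ × ℝ) :
    tentSum^[j + 1] F p =
      tentSum^[j] (fun q => F (tentBranch false false q)) p +
      tentSum^[j] (fun q => F (tentBranch true true q)) p +
      tentSum^[j] (fun q => F (tentBranch false true q)) p +
      tentSum^[j] (fun q => F (tentBranch true false q)) p := by
  rw [Function.iterate_succ_apply]
  simp only [← iterate_tentSum_add]
  rfl

lemma tentBranch_symm (b e : Bool) (p : ℝ × ℝ) :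
    tentBranch (!b) (!e) p = (2⁻¹, 2⁻¹) - (tentBranch b e p - (2⁻¹, 2⁻¹)) := by
  cases b <;> cases e <;> ext <;> simp [tentBranch, tentInv] <;> ring

lemma SecondDiffBound.pair {K : ℝ} {F : ℝ × ℝ → ℝ} (hK : 0 ≤ K)
    (hF : SecondDiffBound unitSq K F) (b e : Bool) {p : ℝ × ℝ} (hp : p ∈ unitSq) :
    |F (tentBranch b e p) + F (tentBranch (!b) (!e) p) - 2 * F (2⁻¹, 2⁻¹)| ≤ K / 4 := by
  have h := hF (2⁻¹, 2⁻¹) (tentBranch b e p - (2⁻¹, 2⁻¹))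
    (by simpa using tentBranch_mem b e hp)
    (by rw [← tentBranch_symm]; exact tentBranch_mem _ _ hp)
  rw [← tentBranch_symm, add_sub_cancel] at h
  have hn : ‖tentBranch b e p - (2⁻¹, 2⁻¹)‖ ≤ 1 / 2 := by
    have hm := mem_unitSq.1 (tentBranch_mem b e hp)
    rw [norm_prod_le_iff]
    simp only [Prod.fst_sub, Prod.snd_sub, Real.norm_eq_abs, abs_le]
    refine ⟨⟨?_, ?_⟩, ?_, ?_⟩ <;> linarith
  have h4 : ‖tentBranch b e p - (2⁻¹, 2⁻¹)‖ ^ 2 ≤ 1 / 4 := by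
    nlinarith [norm_nonneg (tentBranch b e p - (2⁻¹, 2⁻¹))]
  nlinarith

lemma SecondDiffBound.osc_le (j : ℕ) {K : ℝ} {F : ℝ × ℝ → ℝ} (hK : 0 ≤ K)
    (hF : SecondDiffBound unitSq K F) {p q : ℝ × ℝ} (hp : p ∈ unitSq) (hq : q ∈ unitSq) :
    |tentSum^[j + 1] F p - tentSum^[j + 1] F q| ≤ K := by
  induction j generalizing F K with
  | zero =>
    have h1 := abs_le.1 (hF.pair hK false false hp)
    have h2 := abs_le.1 (hF.pair hK false true hp)
    have h3 := abs_le.1 (hF.pair hK false false hq)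
    have h4 := abs_le.1 (hF.pair hK false true hq)
    simp only [Bool.not_false, Bool.not_true] at h1 h2 h3 h4
    simp only [zero_add, Function.iterate_one, tentSum]
    rw [abs_le]
    constructor <;> linarith
  | succ j ih =>
    have key : ∀ b e, |tentSum^[j + 1] (fun x => F (tentBranch b e x)) p -
        tentSum^[j + 1] (fun x => F (tentBranch b e x)) q| ≤ K / 4 := fun b e =>
      ih (by positivity) (hF.comp_tentBranch b e fun x hx => tentBranch_mem b e hx)
    rw [iterate_succ_tentSum (j + 1) F p, iterate_succ_tentSum (j + 1) F q]
    have h1 := abs_le.1 (key false false)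
    have h2 := abs_le.1 (key true true)
    have h3 := abs_le.1 (key false true)
    have h4 := abs_le.1 (key true false)
    rw [abs_le]
    constructor <;> linarith

lemma FoldBound.comp_false {L K : ℝ} {F : ℝ × ℝ → ℝ} (hF : FoldBound L K F) :
    FoldBound (L / 2) (K / 4) (fun p => F (tentBranch false false p)) where
  lip p hp q hq := by
    refine (hF.lip _ (tentBranch_mem _ _ hp) _ (tentBranch_mem _ _ hq)).trans (le_of_eq ?_)
    rw [norm_tentBranch_sub]
    ring
  lower := hF.lower.comp_tentBranch _ _ fun p hp =>
    ⟨tentBranch_mem _ _ hp.1, by have := hp.2; simp [tentBranch, tentInv]; linarith⟩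
  upper := hF.upper.comp_tentBranch _ _ fun p hp =>
    ⟨tentBranch_mem _ _ hp.1, by have := hp.2; simp [tentBranch, tentInv]; linarith⟩

lemma FoldBound.comp_true {L K : ℝ} {F : ℝ × ℝ → ℝ} (hF : FoldBound L K F) :
    FoldBound (L / 2) (K / 4) (fun p => F (tentBranch true true p)) where
  lip p hp q hq := by
    refine (hF.lip _ (tentBranch_mem _ _ hp) _ (tentBranch_mem _ _ hq)).trans (le_of_eq ?_)
    rw [norm_tentBranch_sub]
    ring
  lower := hF.upper.comp_tentBranch _ _ fun p hp =>
    ⟨tentBranch_mem _ _ hp.1, by have := hp.2; simp [tentBranch, tentInv]; linarith⟩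
  upper := hF.lower.comp_tentBranch _ _ fun p hp =>
    ⟨tentBranch_mem _ _ hp.1, by have := hp.2; simp [tentBranch, tentInv]; linarith⟩

lemma norm_sub_le_one_of_mem_unitSq {p q : ℝ × ℝ} (hp : p ∈ unitSq) (hq : q ∈ unitSq) :
    ‖p - q‖ ≤ 1 := by
  rw [mem_unitSq] at hp hq
  rw [norm_prod_le_iff]
  simp only [Prod.fst_sub, Prod.snd_sub, Real.norm_eq_abs, abs_le]
  refine ⟨⟨?_, ?_⟩, ?_, ?_⟩ <;> linarith

/-- The iterates of the transfer operator have oscillation bounded independently of the number of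
iterations: only the `2^j` cells met by the diagonal do not profit from the second differences. -/
lemma FoldBound.osc_le (j : ℕ) {L K : ℝ} {F : ℝ × ℝ → ℝ} (hL : 0 ≤ L) (hK : 0 ≤ K)
    (hF : FoldBound L K F) {p q : ℝ × ℝ} (hp : p ∈ unitSq) (hq : q ∈ unitSq) :
    |tentSum^[j] F p - tentSum^[j] F q| ≤ 2 * L + K := by
  have hn := norm_sub_le_one_of_mem_unitSq hp hq
  induction j generalizing F L K with
  | zero =>
    refine (hF.lip p hp q hq).trans ?_
    nlinarith
  | succ j ih =>
    have h1 := abs_le.1 (ih (by positivity) (by positivity) hF.comp_false)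
    have h2 := abs_le.1 (ih (by positivity) (by positivity) hF.comp_true)
    rw [iterate_succ_tentSum j F p, iterate_succ_tentSum j F q]
    cases j with
    | zero =>
      have key : ∀ b e, |F (tentBranch b e p) - F (tentBranch b e q)| ≤ L / 2 := by
        intro b e
        refine (hF.lip _ (tentBranch_mem b e hp) _ (tentBranch_mem b e hq)).trans ?_
        rw [norm_tentBranch_sub]
        nlinarith
      have h1 := abs_le.1 (key false false)
      have h2 := abs_le.1 (key true true)
      have h3 := abs_le.1 (key false true)
      have h4 := abs_le.1 (key true false)
      simp only [Function.iterate_zero, id]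
      rw [abs_le]
      constructor <;> linarith
    | succ j =>
      have h3 := abs_le.1 <| (hF.upper.comp_tentBranch false true
        fun x hx => tentBranch_false_true_mem hx).osc_le j (by positivity) hp hq
      have h4 := abs_le.1 <| (hF.lower.comp_tentBranch true false
        fun x hx => tentBranch_true_false_mem hx).osc_le j (by positivity) hp hq
      rw [abs_le]
      constructor <;> linarith

lemma continuous_tentInv (b : Bool) : Continuous (tentInv b) := by
  unfold tentInv
  cases b
  · exact continuous_id.div_const 2
  · exact continuous_const.sub (continuous_id.div_const 2)

lemma continuous_tentBranch (b c : Bool) : Continuous (tentBranch b c) :=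
  ((continuous_tentInv b).comp continuous_fst).prodMk ((continuous_tentInv c).comp continuous_snd)

lemma continuous_tentSum {F : ℝ × ℝ → ℝ} (hF : Continuous F) : Continuous (tentSum F) := by
  unfold tentSum
  have := fun b c => hF.comp (continuous_tentBranch b c)
  exact (((this _ _).add (this _ _)).add (this _ _)).add (this _ _)

lemma continuous_iterate_tentSum {F : ℝ × ℝ → ℝ} (hF : Continuous F) (j : ℕ) :
    Continuous (tentSum^[j] F) := by
  induction j generalizing F with
  | zero => exact hF
  | succ j ih => exact ih (continuous_tentSum hF)

/-- The integral over the unit square, as an iterated integral. -/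
def sqInt (F : ℝ × ℝ → ℝ) : ℝ := ∫ s in (0 : ℝ)..1, ∫ t in (0 : ℝ)..1, F (s, t)

lemma integral_tentInv {g : ℝ → ℝ} (hg : Continuous g) :
    (∫ s in (0 : ℝ)..1, (g (tentInv false s) + g (tentInv true s))) =
      2 * ∫ s in (0 : ℝ)..1, g s := by
  have hi : ∀ b, IntervalIntegrable (fun s => g (tentInv b s)) volume 0 1 := fun b =>
    (hg.comp (continuous_tentInv b)).intervalIntegrable _ _
  rw [intervalIntegral.integral_add (hi _) (hi _)]
  have h1 : (∫ s in (0 : ℝ)..1, g (tentInv false s)) = 2 * ∫ s in (0 : ℝ)..(1 / 2), g s := by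
    simp [tentInv]
  have h2 : (∫ s in (0 : ℝ)..1, g (tentInv true s)) = 2 * ∫ s in (1 / 2 : ℝ)..1, g s := by
    simp only [tentInv, if_true]
    rw [intervalIntegral.integral_comp_sub_div (f := g) (by norm_num)]
    norm_num
  rw [h1, h2, ← intervalIntegral.integral_add_adjacent_intervals
    (hg.intervalIntegrable 0 (1 / 2)) (hg.intervalIntegrable (1 / 2) 1)]
  ring

lemma sqInt_tentSum {F : ℝ × ℝ → ℝ} (hF : Continuous F) : sqInt (tentSum F) = 4 * sqInt F := by
  have hH : Continuous fun s : ℝ => ∫ t in (0 : ℝ)..1, F (s, t) :=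
    intervalIntegral.continuous_parametric_intervalIntegral_of_continuous'
      (f := fun s t => F (s, t)) hF 0 1
  have inner : ∀ s : ℝ, (∫ t in (0 : ℝ)..1, tentSum F (s, t)) =
      2 * ((∫ t in (0 : ℝ)..1, F (tentInv false s, t)) +
        ∫ t in (0 : ℝ)..1, F (tentInv true s, t)) := by
    intro s
    have hc : ∀ x : ℝ, Continuous fun t => F (x, t) := fun x => by fun_prop
    have hi : ∀ b x, IntervalIntegrable (fun t => F (x, tentInv b t)) volume 0 1 := fun b x =>
      ((hc x).comp (continuous_tentInv b)).intervalIntegrable _ _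
    rw [mul_add, ← integral_tentInv (hc _), ← integral_tentInv (hc _),
      ← intervalIntegral.integral_add ((hi _ _).add (hi _ _)) ((hi _ _).add (hi _ _))]
    refine intervalIntegral.integral_congr fun t _ => ?_
    simp only [tentSum, tentBranch]
    ring
  simp only [sqInt, inner]
  rw [intervalIntegral.integral_const_mul, integral_tentInv hH]
  ring

lemma sqInt_iterate_tentSum {F : ℝ × ℝ → ℝ} (hF : Continuous F) (j : ℕ) :
    sqInt (tentSum^[j] F) = 4 ^ j * sqInt F := by
  induction j generalizing F with
  | zero => simp
  | succ j ih =>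
    rw [Function.iterate_succ_apply, ih (continuous_tentSum hF), sqInt_tentSum hF]
    ring

lemma abs_sub_sqInt_le {F : ℝ × ℝ → ℝ} (hF : Continuous F) {K : ℝ} {p : ℝ × ℝ}
    (h : ∀ q ∈ unitSq, |F p - F q| ≤ K) : |F p - sqInt F| ≤ K := by
  have hH : Continuous fun s : ℝ => ∫ t in (0 : ℝ)..1, F (s, t) :=
    intervalIntegral.continuous_parametric_intervalIntegral_of_continuous'
      (f := fun s t => F (s, t)) hF 0 1
  have hc : ∀ x : ℝ, Continuous fun t => F (x, t) := fun x => by fun_prop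
  have hin : ∀ s : ℝ, F p - (∫ t in (0 : ℝ)..1, F (s, t)) = ∫ t in (0 : ℝ)..1, (F p - F (s, t)) := by
    intro s
    rw [intervalIntegral.integral_sub intervalIntegrable_const ((hc s).intervalIntegrable _ _)]
    simp
  have hout : F p - sqInt F = ∫ s in (0 : ℝ)..1, ∫ t in (0 : ℝ)..1, (F p - F (s, t)) := by
    simp only [← hin]
    rw [intervalIntegral.integral_sub intervalIntegrable_const (hH.intervalIntegrable _ _)]
    simp [sqInt]
  rw [hout, ← Real.norm_eq_abs]
  refine (intervalIntegral.norm_integral_le_of_norm_le_const (C := K) fun s hs => ?_).trans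
    (by simp)
  refine (intervalIntegral.norm_integral_le_of_norm_le_const (C := K) fun t ht => ?_).trans
    (by simp)
  rw [Set.uIoc_of_le zero_le_one] at hs ht
  exact h _ (mem_unitSq.2 ⟨⟨hs.1.le, hs.2⟩, ht.1.le, ht.2⟩)

lemma tentPt_eq (n : ℕ) :
    tentPt n = tentBranch (decide (n % 2 = 1)) (decide (n / 2 % 2 = 1)) (tentPt (n / 4)) := by
  rw [tentPt]
  split_ifs with h
  · subst h
    simp [tentPt, tentBranch, tentInv]
  · rfl

lemma tentPt_mem (n : ℕ) : tentPt n ∈ unitSq := by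
  induction n using Nat.strong_induction_on with
  | _ n ih =>
    by_cases h : n = 0
    · subst h
      simp [tentPt, mem_unitSq]
    · rw [tentPt_eq]
      exact tentBranch_mem _ _ (ih _ (by omega))

lemma sum_tentPt_four_mul (F : ℝ × ℝ → ℝ) (N : ℕ) :
    ∑ k ∈ Finset.range (4 * N), F (tentPt k) = ∑ k ∈ Finset.range N, tentSum F (tentPt k) := by
  induction N with
  | zero => simp
  | succ N ih =>
    have e0 : tentPt (4 * N) = tentBranch false false (tentPt N) := by
      rw [tentPt_eq, show 4 * N / 4 = N by omega, show 4 * N % 2 = 0 by omega,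
        show 4 * N / 2 % 2 = 0 by omega]
      rfl
    have e1 : tentPt (4 * N + 1) = tentBranch true false (tentPt N) := by
      rw [tentPt_eq, show (4 * N + 1) / 4 = N by omega, show (4 * N + 1) % 2 = 1 by omega,
        show (4 * N + 1) / 2 % 2 = 0 by omega]
      rfl
    have e2 : tentPt (4 * N + 2) = tentBranch false true (tentPt N) := by
      rw [tentPt_eq, show (4 * N + 2) / 4 = N by omega, show (4 * N + 2) % 2 = 0 by omega,
        show (4 * N + 2) / 2 % 2 = 1 by omega]
      rfl
    have e3 : tentPt (4 * N + 3) = tentBranch true true (tentPt N) := by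
      rw [tentPt_eq, show (4 * N + 3) / 4 = N by omega, show (4 * N + 3) % 2 = 1 by omega,
        show (4 * N + 3) / 2 % 2 = 1 by omega]
      rfl
    rw [show 4 * (N + 1) = 4 * N + 1 + 1 + 1 + 1 by ring, Finset.sum_range_succ,
      Finset.sum_range_succ, Finset.sum_range_succ, Finset.sum_range_succ, ih,
      Finset.sum_range_succ, e0, e1, e2, e3]
    simp only [tentSum]
    ring

lemma abs_sum_tentPt_sub_le (m : ℕ) {F : ℝ × ℝ → ℝ} {I K : ℝ}
    (h : ∀ j, ∀ p ∈ unitSq, |tentSum^[j] F p - 4 ^ j * I| ≤ K) (N : ℕ) (hN : N < 4 ^ m) :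
    |∑ k ∈ Finset.range N, F (tentPt k) - N * I| ≤ 3 * K * m := by
  induction m generalizing F I N with
  | zero =>
    have : N = 0 := by simpa using hN
    simp [this]
  | succ m ih =>
    have hq := ih (F := tentSum F) (I := 4 * I) (fun j p hp => by
      have := h (j + 1) p hp
      rwa [Function.iterate_succ_apply, pow_succ, mul_assoc] at this) (N / 4)
      (by rw [pow_succ] at hN; omega)
    rw [← sum_tentPt_four_mul] at hq
    have hK : 0 ≤ K := (abs_nonneg _).trans (h 0 _ (tentPt_mem 0))
    have hr : ∀ M r : ℕ, |∑ k ∈ Finset.range (M + r), F (tentPt k) - (M + r : ℕ) * I| ≤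
        |∑ k ∈ Finset.range M, F (tentPt k) - M * I| + r * K := by
      intro M r
      induction r with
      | zero => simp
      | succ r ihr =>
        rw [← add_assoc, Finset.sum_range_succ]
        have h0 := h 0 _ (tentPt_mem (M + r))
        simp only [Function.iterate_zero, id, pow_zero, one_mul] at h0
        have e : ∑ k ∈ Finset.range (M + r), F (tentPt k) + F (tentPt (M + r)) -
            (M + r + 1 : ℕ) * I = (∑ k ∈ Finset.range (M + r), F (tentPt k) - (M + r : ℕ) * I) +
              (F (tentPt (M + r)) - I) := by push_cast; ring
        rw [e]
        refine (abs_add_le _ _).trans ?_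
        push_cast at ihr ⊢
        linarith
    have h1 := hr (4 * (N / 4)) (N % 4)
    rw [Nat.div_add_mod] at h1
    have h3 : ((N % 4 : ℕ) : ℝ) ≤ 3 := by exact_mod_cast (by omega : N % 4 ≤ 3)
    have e2 : ((4 * (N / 4) : ℕ) : ℝ) * I = (N / 4 : ℕ) * (4 * I) := by push_cast; ring
    rw [e2] at h1
    push_cast at hq h1 ⊢
    nlinarith

/-- The quadrature error of the tent sequence for functions that are Lipschitz on the unit square
and have bounded second differences on both sides of the diagonal. -/
lemma FoldBound.abs_sum_tentPt_sub_le {L K : ℝ} {F : ℝ × ℝ → ℝ} (hL : 0 ≤ L) (hK : 0 ≤ K)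
    (hF : FoldBound L K F) (hc : Continuous F) (m N : ℕ) (hN : N < 4 ^ m) :
    |∑ k ∈ Finset.range N, F (tentPt k) - N * sqInt F| ≤ 3 * (2 * L + K) * m := by
  refine _root_.abs_sum_tentPt_sub_le m (fun j p hp => ?_) N hN
  rw [← sqInt_iterate_tentSum hc]
  exact abs_sub_sqInt_le (continuous_iterate_tentSum hc j) fun q hq => hF.osc_le j hL hK hp hq

lemma abs_apply_le_of_supAbs_le {T : Set Pt} {g : Pt → ℝ} {M : ℝ} (hT : IsCompact T)
    (hg : ContinuousOn g T) (h : supAbs T g ≤ M) {x : Pt} (hx : x ∈ T) : |g x| ≤ M := by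
  obtain ⟨R, hR⟩ := hT.exists_bound_of_continuousOn hg
  refine le_trans ?_ h
  have hb : BddAbove (Set.range fun y => ⨆ _ : y ∈ T, |g y|) := by
    refine ⟨max R 0, ?_⟩
    rintro _ ⟨y, rfl⟩
    refine Real.iSup_le (fun hy => (hR y hy).trans (le_max_left _ _)) (le_max_right _ _)
  refine le_trans ?_ (le_ciSup hb x)
  simp [hx]

lemma apply_eq_coords (D : Pt →L[ℝ] ℝ) (v : Pt) : D v = v 0 * D dir1 + v 1 * D dir2 := by
  have : v = v 0 • dir1 + v 1 • dir2 := by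
    ext i
    fin_cases i <;> simp [dir1, dir2]
  conv_lhs => rw [this]
  simp

lemma opNorm_le_of_coords {D : Pt →L[ℝ] ℝ} {M : ℝ} (hM : 0 ≤ M) (h1 : |D dir1| ≤ M)
    (h2 : |D dir2| ≤ M) : ‖D‖ ≤ 2 * M := by
  refine D.opNorm_le_bound (by positivity) fun v => ?_
  rw [apply_eq_coords, Real.norm_eq_abs]
  have hv0 : |v 0| ≤ ‖v‖ := PiLp.norm_apply_le v 0
  have hv1 : |v 1| ≤ ‖v‖ := PiLp.norm_apply_le v 1
  refine (abs_add_le _ _).trans ?_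
  rw [abs_mul, abs_mul]
  have := mul_le_mul hv0 h1 (abs_nonneg _) (norm_nonneg _)
  have := mul_le_mul hv1 h2 (abs_nonneg _) (norm_nonneg _)
  linarith

lemma pdW_pdW {T : Set Pt} {f : Pt → ℝ} (hu : UniqueDiffOn ℝ T)
    (hf : DifferentiableOn ℝ (fderivWithin ℝ f T) T) {x : Pt} (hx : x ∈ T) (v w : Pt) :
    pdW T v (pdW T w f) x = fderivWithin ℝ (fderivWithin ℝ f T) T x v w := by
  have h := (hf x hx).hasFDerivWithinAt.clm_apply (hasFDerivWithinAt_const w x T)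
  change fderivWithin ℝ (fun y => fderivWithin ℝ f T y w) T x v = _
  rw [h.fderivWithin (hu x hx)]
  simp

/-- First and second derivative bounds extracted from `c2Norm`. -/
lemma fderivWithin_bounds_of_c2Norm_le {T : Set Pt} {f : Pt → ℝ} (hT : IsCompact T)
    (hconv : Convex ℝ T) (hInt : (interior T).Nonempty) (hf : ContDiffOn ℝ 2 f T)
    (hn : c2Norm T f ≤ 1) {x : Pt} (hx : x ∈ T) :
    ‖fderivWithin ℝ f T x‖ ≤ 2 ∧ ‖fderivWithin ℝ (fderivWithin ℝ f T) T x‖ ≤ 4 := by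
  have hu : UniqueDiffOn ℝ T := uniqueDiffOn_convex hconv hInt
  have hD : ContDiffOn ℝ 1 (fderivWithin ℝ f T) T := hf.fderivWithin hu (by norm_num)
  have hDD : ContinuousOn (fderivWithin ℝ (fderivWithin ℝ f T) T) T :=
    hD.continuousOn_fderivWithin hu le_rfl
  have hDd : DifferentiableOn ℝ (fderivWithin ℝ f T) T := hD.differentiableOn one_ne_zero
  have hc1 : ∀ v, ContinuousOn (pdW T v f) T := fun v =>
    hD.continuousOn.clm_apply continuousOn_const
  have hc2 : ∀ v w, ContinuousOn (pdW T v (pdW T w f)) T := fun v w =>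
    ((hDD.clm_apply continuousOn_const).clm_apply continuousOn_const).congr
      fun y hy => pdW_pdW hu hDd hy v w
  simp only [c2Norm, max_le_iff] at hn
  obtain ⟨-, ⟨h1, h2⟩, h11, h21, h22⟩ := hn
  have b1 := abs_apply_le_of_supAbs_le hT (hc1 _) h1 hx
  have b2 := abs_apply_le_of_supAbs_le hT (hc1 _) h2 hx
  have b11 := abs_apply_le_of_supAbs_le hT (hc2 _ _) h11 hx
  have b21 := abs_apply_le_of_supAbs_le hT (hc2 _ _) h21 hx
  have b22 := abs_apply_le_of_supAbs_le hT (hc2 _ _) h22 hx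
  rw [pdW_pdW hu hDd hx] at b11 b21 b22
  have hsym : IsSymmSndFDerivWithinAt ℝ f T x :=
    (hf x hx).isSymmSndFDerivWithinAt (by simp) hu
      (by rw [hconv.closure_interior_eq_closure_of_nonempty_interior hInt]; exact subset_closure hx)
      hx
  have b12 := b21
  rw [hsym.eq] at b12
  refine ⟨(opNorm_le_of_coords zero_le_one b1 b2).trans (by norm_num), ?_⟩
  refine ContinuousLinearMap.opNorm_le_bound _ (by norm_num) fun v => ?_
  have key : ∀ w, |fderivWithin ℝ (fderivWithin ℝ f T) T x w dir1| ≤ 2 * ‖w‖ ∧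
      |fderivWithin ℝ (fderivWithin ℝ f T) T x w dir2| ≤ 2 * ‖w‖ := by
    intro w
    constructor
    · exact ((((fderivWithin ℝ (fderivWithin ℝ f T) T x).flip dir1).le_opNorm w).trans
        (mul_le_mul_of_nonneg_right (opNorm_le_of_coords zero_le_one (by simpa using b11)
          (by simpa using b21)) (norm_nonneg _))).trans (by norm_num)
    · exact ((((fderivWithin ℝ (fderivWithin ℝ f T) T x).flip dir2).le_opNorm w).trans
        (mul_le_mul_of_nonneg_right (opNorm_le_of_coords zero_le_one (by simpa using b12)
          (by simpa using b22)) (norm_nonneg _))).trans (by norm_num)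
  refine (opNorm_le_of_coords (by positivity) (key v).1 (key v).2).trans (le_of_eq ?_)
  ring

lemma abs_sub_le_of_c2Norm_le {T : Set Pt} {f : Pt → ℝ} (hT : IsCompact T)
    (hconv : Convex ℝ T) (hInt : (interior T).Nonempty) (hf : ContDiffOn ℝ 2 f T)
    (hn : c2Norm T f ≤ 1) {x y : Pt} (hx : x ∈ T) (hy : y ∈ T) :
    |f x - f y| ≤ 2 * ‖x - y‖ :=
  hconv.norm_image_sub_le_of_norm_fderivWithin_le (hf.differentiableOn two_ne_zero)
    (fun _ hz => (fderivWithin_bounds_of_c2Norm_le hT hconv hInt hf hn hz).1) hy hx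

lemma abs_second_diff_le_of_c2Norm_le {T : Set Pt} {f : Pt → ℝ} (hT : IsCompact T)
    (hconv : Convex ℝ T) (hInt : (interior T).Nonempty) (hf : ContDiffOn ℝ 2 f T)
    (hn : c2Norm T f ≤ 1) {c d : Pt} (h1 : c + d ∈ T) (h2 : c - d ∈ T) :
    |f (c + d) + f (c - d) - 2 * f c| ≤ 8 * ‖d‖ ^ 2 := by
  have hu : UniqueDiffOn ℝ T := uniqueDiffOn_convex hconv hInt
  have hD : ContDiffOn ℝ 1 (fderivWithin ℝ f T) T := hf.fderivWithin hu (by norm_num)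
  have hc : c ∈ T := by
    have := hconv h1 h2 (by norm_num : (0 : ℝ) ≤ 1 / 2) (by norm_num : (0 : ℝ) ≤ 1 / 2)
      (by norm_num)
    convert this using 1
    module
  have lipD : ∀ y ∈ T, ‖fderivWithin ℝ f T y - fderivWithin ℝ f T c‖ ≤ 4 * ‖y - c‖ := fun y hy =>
    hconv.norm_image_sub_le_of_norm_fderivWithin_le (hD.differentiableOn one_ne_zero)
      (fun _ hz => (fderivWithin_bounds_of_c2Norm_le hT hconv hInt hf hn hz).2) hc hy
  have taylor : ∀ e : Pt, ‖e‖ = ‖d‖ → c + e ∈ T →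
      |f (c + e) - f c - fderivWithin ℝ f T c e| ≤ 4 * ‖d‖ * ‖d‖ := by
    intro e he hce
    have := (hconv.inter (convex_closedBall c ‖d‖)).norm_image_sub_le_of_norm_hasFDerivWithin_le'
      (f := f) (f' := fderivWithin ℝ f T) (φ := fderivWithin ℝ f T c) (C := 4 * ‖d‖)
      (x := c) (y := c + e)
      (fun y hy => ((hf.differentiableOn two_ne_zero) y hy.1).hasFDerivWithinAt.mono
        Set.inter_subset_left)
      (fun y hy => (lipD y hy.1).trans
        (mul_le_mul_of_nonneg_left (mem_closedBall_iff_norm.1 hy.2) (by norm_num)))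
      ⟨hc, by simp⟩ ⟨hce, by simp [he]⟩
    rwa [add_sub_cancel_left, he] at this
  have t1 := abs_le.1 (taylor d rfl h1)
  have t2 := abs_le.1 (taylor (-d) (norm_neg d) (by rwa [← sub_eq_add_neg]))
  rw [← sub_eq_add_neg, map_neg] at t2
  rw [abs_le]
  constructor <;> nlinarith

/-- The affine parametrisation of the triangle `tri A B C` by `lowerHalf`. -/
def triMap (A B C : Pt) (p : ℝ × ℝ) : Pt := (1 - p.1) • A + (p.1 - p.2) • B + p.2 • C

/-- The linear part of `triMap A B C`. -/
def triLin (A B C : Pt) : ℝ × ℝ →L[ℝ] Pt :=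
  (ContinuousLinearMap.fst ℝ ℝ ℝ).smulRight (B - A) +
    (ContinuousLinearMap.snd ℝ ℝ ℝ).smulRight (C - B)

/-- The retraction of the plane onto `lowerHalf` that clamps to the unit square and then folds
along the diagonal. -/
def foldPt (p : ℝ × ℝ) : ℝ × ℝ :=
  (max (max 0 (min 1 p.1)) (max 0 (min 1 p.2)), min (max 0 (min 1 p.1)) (max 0 (min 1 p.2)))

lemma continuous_foldPt : Continuous foldPt := by
  unfold foldPt
  fun_prop

lemma foldPt_mem (p : ℝ × ℝ) : foldPt p ∈ lowerHalf := by
  have h : ∀ x : ℝ, 0 ≤ max 0 (min 1 x) ∧ max 0 (min 1 x) ≤ 1 := fun x =>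
    ⟨le_max_left _ _, max_le zero_le_one (min_le_left _ _)⟩
  refine ⟨mem_unitSq.2 ⟨⟨?_, ?_⟩, ?_, ?_⟩, ?_⟩
  · exact (h p.1).1.trans (le_max_left _ _)
  · exact max_le (h _).2 (h _).2
  · exact le_min (h _).1 (h _).1
  · exact (min_le_left _ _).trans (h _).2
  · exact min_le_max

lemma foldPt_of_mem_unitSq {p : ℝ × ℝ} (hp : p ∈ unitSq) :
    foldPt p = (max p.1 p.2, min p.1 p.2) := by
  rw [mem_unitSq] at hp
  simp [foldPt, hp.1.1, hp.1.2, hp.2.1, hp.2.2]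

lemma foldPt_of_mem_lowerHalf {p : ℝ × ℝ} (hp : p ∈ lowerHalf) : foldPt p = p := by
  simp [foldPt_of_mem_unitSq hp.1, hp.2]

lemma foldPt_of_mem_upperHalf {p : ℝ × ℝ} (hp : p ∈ upperHalf) : foldPt p = p.swap := by
  simp [foldPt_of_mem_unitSq hp.1, hp.2, Prod.swap]

lemma norm_foldPt_sub_le {p q : ℝ × ℝ} (hp : p ∈ unitSq) (hq : q ∈ unitSq) :
    ‖foldPt p - foldPt q‖ ≤ ‖p - q‖ := by
  rw [foldPt_of_mem_unitSq hp, foldPt_of_mem_unitSq hq, norm_prod_le_iff, Prod.norm_def]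
  exact ⟨abs_max_sub_max_le_max _ _ _ _, abs_min_sub_min_le_max _ _ _ _⟩

lemma triMap_eq (A B C : Pt) (p : ℝ × ℝ) : triMap A B C p = A + triLin A B C p := by
  simp only [triMap, triLin, _root_.add_apply, ContinuousLinearMap.smulRight_apply,
    ContinuousLinearMap.coe_fst', ContinuousLinearMap.coe_snd']
  module

lemma tri_eq_image (A B C : Pt) : tri A B C = triMap A B C '' lowerHalf := by
  ext x
  constructor
  · rintro ⟨w1, w2, w3, h1, h2, h3, hs, rfl⟩
    refine ⟨(w2 + w3, w3), ⟨mem_unitSq.2 ⟨⟨?_, ?_⟩, ?_, ?_⟩, ?_⟩, ?_⟩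
    any_goals simp only; linarith
    simp only [triMap]
    rw [show 1 - (w2 + w3) = w1 by linarith, show w2 + w3 - w3 = w2 by ring]
  · rintro ⟨p, ⟨hp, hle⟩, rfl⟩
    rw [mem_unitSq] at hp
    exact ⟨1 - p.1, p.1 - p.2, p.2, by linarith, by linarith, by linarith, by ring, rfl⟩

lemma triLin_injective {A B C : Pt} (hT : AffineIndependent ℝ ![A, B, C]) :
    Function.Injective (triLin A B C) := by
  rw [injective_iff_map_eq_zero]
  intro p hp
  rw [affineIndependent_iff] at hT
  have h := hT Finset.univ ![-p.1, p.1 - p.2, p.2] (by simp [Fin.sum_univ_three]; ring)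
    (by
      rw [← hp]
      simp only [Fin.sum_univ_three, triLin, _root_.add_apply,
        ContinuousLinearMap.smulRight_apply, ContinuousLinearMap.coe_fst',
        ContinuousLinearMap.coe_snd', Matrix.cons_val_zero, Matrix.cons_val_one, Matrix.cons_val]
      module)
  have h0 := h 0 (Finset.mem_univ _)
  have h2 := h 2 (Finset.mem_univ _)
  ext
  · simpa using h0
  · simpa using h2

/-- `triLin` as a continuous linear equivalence, for a nondegenerate triangle. -/
def triEquiv {A B C : Pt} (hT : AffineIndependent ℝ ![A, B, C]) : (ℝ × ℝ) ≃L[ℝ] Pt :=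
  (LinearEquiv.ofInjectiveOfFinrankEq (triLin A B C : ℝ × ℝ →ₗ[ℝ] Pt) (triLin_injective hT)
    (by simp)).toContinuousLinearEquiv

lemma triEquiv_apply {A B C : Pt} (hT : AffineIndependent ℝ ![A, B, C]) (p : ℝ × ℝ) :
    triEquiv hT p = triLin A B C p := by
  rfl

lemma isClosed_lowerHalf : IsClosed lowerHalf :=
  isClosed_Icc.inter (isClosed_le continuous_snd continuous_fst)

lemma isCompact_lowerHalf : IsCompact lowerHalf :=
  (isCompact_Icc (a := (0 : ℝ × ℝ)) (b := 1)).inter_right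
    (isClosed_le continuous_snd continuous_fst)

lemma convex_lowerHalf : Convex ℝ lowerHalf := by
  refine (convex_Icc (0 : ℝ × ℝ) 1).inter ?_
  intro p (hp : p.2 ≤ p.1) q (hq : q.2 ≤ q.1) a b ha hb _
  change a * p.2 + b * q.2 ≤ a * p.1 + b * q.1
  gcongr

lemma interior_lowerHalf_nonempty : (interior lowerHalf).Nonempty := by
  refine ⟨(2 / 3, 1 / 3), mem_interior.2
    ⟨{p | p.1 < 1} ∩ {p | 0 < p.2} ∩ {p | p.2 < p.1}, ?_, ?_, ?_⟩⟩
  · rintro p ⟨⟨h1, h2⟩, h3⟩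
    simp only [Set.mem_ofPred_eq] at h1 h2 h3
    exact ⟨mem_unitSq.2 ⟨⟨by linarith, by linarith⟩, by linarith, by linarith⟩, h3.le⟩
  · exact ((isOpen_lt continuous_fst continuous_const).inter
      (isOpen_lt continuous_const continuous_snd)).inter (isOpen_lt continuous_snd continuous_fst)
  · norm_num

/-- `triMap` as a homeomorphism, for a nondegenerate triangle. -/
def triHomeo {A B C : Pt} (hT : AffineIndependent ℝ ![A, B, C]) : (ℝ × ℝ) ≃ₜ Pt :=
  (triEquiv hT).toHomeomorph.trans (Homeomorph.addLeft A)

lemma triHomeo_apply {A B C : Pt} (hT : AffineIndependent ℝ ![A, B, C]) (p : ℝ × ℝ) :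
    triHomeo hT p = triMap A B C p := by
  rw [triMap_eq, ← triEquiv_apply hT]
  rfl

lemma tri_eq_image_triHomeo {A B C : Pt} (hT : AffineIndependent ℝ ![A, B, C]) :
    tri A B C = triHomeo hT '' lowerHalf := by
  rw [tri_eq_image]
  exact Set.image_congr fun p _ => (triHomeo_apply hT p).symm

lemma continuous_triMap (A B C : Pt) : Continuous (triMap A B C) := by
  unfold triMap
  fun_prop

lemma isCompact_tri (A B C : Pt) : IsCompact (tri A B C) := by
  rw [tri_eq_image]
  exact isCompact_lowerHalf.image (continuous_triMap A B C)

lemma convex_tri (A B C : Pt) : Convex ℝ (tri A B C) := by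
  rw [tri_eq_image, show triMap A B C = (fun x => A + x) ∘ triLin A B C from
    funext (triMap_eq A B C), Set.image_comp]
  exact (convex_lowerHalf.linear_image (triLin A B C).toLinearMap).translate A

lemma interior_tri_nonempty {A B C : Pt} (hT : AffineIndependent ℝ ![A, B, C]) :
    (interior (tri A B C)).Nonempty := by
  rw [tri_eq_image_triHomeo hT, ← Homeomorph.image_interior]
  exact interior_lowerHalf_nonempty.image _

lemma foldBound_comp_triMap {A B C : Pt} (hT : AffineIndependent ℝ ![A, B, C]) {f : Pt → ℝ}
    (hf : ContDiffOn ℝ 2 f (tri A B C)) (hn : c2Norm (tri A B C) f ≤ 1) :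
    FoldBound (2 * ‖triLin A B C‖) (8 * ‖triLin A B C‖ ^ 2)
      (fun p => f (triMap A B C (foldPt p))) := by
  have hc := isCompact_tri A B C
  have hv := convex_tri A B C
  have hi := interior_tri_nonempty hT
  have hmem : ∀ p ∈ lowerHalf, triMap A B C p ∈ tri A B C := fun p hp => by
    rw [tri_eq_image]
    exact Set.mem_image_of_mem _ hp
  have key : ∀ c d, c + d ∈ lowerHalf → c - d ∈ lowerHalf →
      |f (triMap A B C (c + d)) + f (triMap A B C (c - d)) - 2 * f (triMap A B C c)| ≤
        8 * ‖triLin A B C‖ ^ 2 * ‖d‖ ^ 2 := by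
    intro c d h1 h2
    have e1 : triMap A B C (c + d) = triMap A B C c + triLin A B C d := by
      simp only [triMap_eq, map_add, add_assoc]
    have e2 : triMap A B C (c - d) = triMap A B C c - triLin A B C d := by
      simp only [triMap_eq, map_sub, add_sub_assoc]
    have m1 := hmem _ h1
    have m2 := hmem _ h2
    rw [e1] at m1 ⊢
    rw [e2] at m2 ⊢
    refine (abs_second_diff_le_of_c2Norm_le hc hv hi hf hn m1 m2).trans ?_
    rw [mul_assoc, ← mul_pow]
    gcongr
    exact (triLin A B C).le_opNorm d
  have hmid : ∀ {S : Set (ℝ × ℝ)}, Convex ℝ S → ∀ {c d : ℝ × ℝ}, c + d ∈ S → c - d ∈ S →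
      c ∈ S := by
    intro S hS c d h1 h2
    have := hS h1 h2 (by norm_num : (0 : ℝ) ≤ 1 / 2) (by norm_num : (0 : ℝ) ≤ 1 / 2) (by norm_num)
    convert this using 1
    module
  refine ⟨fun p hp q hq => ?_, fun c d h1 h2 => ?_, fun c d h1 h2 => ?_⟩
  · refine (abs_sub_le_of_c2Norm_le hc hv hi hf hn (hmem _ (foldPt_mem p))
      (hmem _ (foldPt_mem q))).trans ?_
    rw [triMap_eq, triMap_eq, add_sub_add_left_eq_sub, ← map_sub, mul_assoc]
    gcongr
    exact ((triLin A B C).le_opNorm _).trans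
      (mul_le_mul_of_nonneg_left (norm_foldPt_sub_le hp hq) (norm_nonneg _))
  · rw [foldPt_of_mem_lowerHalf h1, foldPt_of_mem_lowerHalf h2,
      foldPt_of_mem_lowerHalf (hmid convex_lowerHalf h1 h2)]
    exact key c d h1 h2
  · have hsw : ∀ {p : ℝ × ℝ}, p ∈ upperHalf → p.swap ∈ lowerHalf := fun {p} hp =>
      ⟨mem_unitSq.2 (mem_unitSq.1 hp.1).symm, hp.2⟩
    have h1' := hsw h1
    have h2' := hsw h2
    have hcs : c.swap ∈ lowerHalf := hmid convex_lowerHalf (d := d.swap) h1' h2'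
    have hcu : c ∈ upperHalf := ⟨mem_unitSq.2 (mem_unitSq.1 hcs.1).symm, hcs.2⟩
    rw [foldPt_of_mem_upperHalf h1, foldPt_of_mem_upperHalf h2, foldPt_of_mem_upperHalf hcu]
    have := key c.swap d.swap h1' h2'
    have hnorm : ‖d.swap‖ = ‖d‖ := by simp [Prod.norm_def, max_comm]
    rwa [hnorm] at this

lemma setIntegral_unitSq {F : ℝ × ℝ → ℝ} (hF : Continuous F) :
    ∫ p in unitSq, F p = sqInt F := by
  have hI : unitSq = Set.Icc (0 : ℝ) 1 ×ˢ Set.Icc (0 : ℝ) 1 := Set.Icc_prod_eq _ _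
  have hInt : IntegrableOn F (Set.Icc (0 : ℝ) 1 ×ˢ Set.Icc (0 : ℝ) 1)
      ((volume : Measure ℝ).prod volume) :=
    hF.continuousOn.integrableOn_compact (isCompact_Icc.prod isCompact_Icc)
  rw [hI, Measure.volume_eq_prod, setIntegral_prod _ hInt]
  simp only [sqInt, intervalIntegral.integral_of_le zero_le_one, integral_Icc_eq_integral_Ioc]

lemma volume_diagonal_eq_zero : volume {p : ℝ × ℝ | p.1 = p.2} = 0 := by
  rw [Measure.volume_eq_prod, Measure.measure_prod_null
    (isClosed_eq continuous_fst continuous_snd).measurableSet]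
  refine Filter.Eventually.of_forall fun x => ?_
  have : Prod.mk x ⁻¹' {p : ℝ × ℝ | p.1 = p.2} = {x} := by
    ext y
    simp [eq_comm]
  simp [this]

lemma two_mul_setIntegral_lowerHalf {F : ℝ × ℝ → ℝ} (hF : Continuous F)
    (hsymm : ∀ p, F p.swap = F p) : 2 * ∫ p in lowerHalf, F p = sqInt F := by
  have hup : IsClosed upperHalf :=
    isClosed_Icc.inter (isClosed_le continuous_fst continuous_snd)
  have hunion : unitSq = lowerHalf ∪ upperHalf := by
    ext p
    have := le_total p.2 p.1
    simp only [lowerHalf, upperHalf, Set.mem_union, Set.mem_ofPred_eq]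
    tauto
  have hdisj : AEDisjoint volume lowerHalf upperHalf :=
    measure_mono_null (fun p hp => le_antisymm hp.2.2 hp.1.2) volume_diagonal_eq_zero
  have hi : IntegrableOn F unitSq := hF.continuousOn.integrableOn_compact isCompact_Icc
  have hswap : ∫ p in upperHalf, F p = ∫ p in lowerHalf, F p := by
    have hmp : MeasurePreserving (Prod.swap : ℝ × ℝ → ℝ × ℝ) volume volume :=
      Measure.measurePreserving_swap
    have h := hmp.setIntegral_preimage_emb MeasurableEquiv.prodComm.measurableEmbedding F lowerHalf
    rw [← h]
    have hpre : Prod.swap ⁻¹' lowerHalf = upperHalf := by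
      ext p
      simp only [lowerHalf, upperHalf, Set.mem_preimage, Set.mem_ofPred_eq, mem_unitSq,
        Prod.fst_swap, Prod.snd_swap]
      tauto
    rw [hpre]
    simp only [hsymm]
  rw [← setIntegral_unitSq hF, hunion, setIntegral_union₀ hdisj hup.nullMeasurableSet
    (hi.mono_set fun _ hp => hp.1) (hi.mono_set fun _ hp => hp.1), hswap]
  ring

lemma continuous_comp_triMap_foldPt {A B C : Pt} {f : Pt → ℝ}
    (hf : ContinuousOn f (tri A B C)) : Continuous fun p => f (triMap A B C (foldPt p)) :=
  hf.comp_continuous ((continuous_triMap A B C).comp continuous_foldPt) fun p => by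
    rw [tri_eq_image]
    exact Set.mem_image_of_mem _ (foldPt_mem p)

/-- The average of a function over the triangle as an integral over the unit square. -/
lemma setAverage_tri {A B C : Pt} (hT : AffineIndependent ℝ ![A, B, C]) {f : Pt → ℝ}
    (hf : ContinuousOn f (tri A B C)) :
    (volume (tri A B C)).toReal⁻¹ * ∫ z in tri A B C, f z =
      sqInt fun p => f (triMap A B C (foldPt p)) := by
  set e := (triHomeo hT).toMeasurableEquiv
  have hmap : ∃ c : NNReal, volume.map e = c • (volume : Measure Pt) := by
    have h1 : volume.map e = (volume.map (triEquiv hT)).map (fun x => A + x) := by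
      rw [Measure.map_map (by fun_prop) (by fun_prop)]
      rfl
    have h2 : (volume.map (triEquiv hT)).map (fun x => A + x) = volume.map (triEquiv hT) :=
      map_add_left_eq_self _ A
    rw [h1, h2]
    exact ⟨_, Measure.isAddLeftInvariant_eq_smul _ _⟩
  obtain ⟨c, hc⟩ := hmap
  have hsym : ∀ p, foldPt p.swap = foldPt p := fun p => by simp [foldPt, max_comm, min_comm]
  have key : ∀ g : Pt → ℝ, ContinuousOn g (tri A B C) →
      2 * (c * ∫ z in tri A B C, g z) = sqInt fun p => g (triMap A B C (foldPt p)) := by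
    intro g hg
    rw [← two_mul_setIntegral_lowerHalf (continuous_comp_triMap_foldPt hg)
      (fun p => by simp only [hsym])]
    have h3 : ∫ z in tri A B C, g z ∂(volume.map e) = c * ∫ z in tri A B C, g z := by
      rw [hc, Measure.restrict_smul, integral_smul_nnreal_measure]
      rfl
    have hpre : e ⁻¹' tri A B C = lowerHalf := by
      rw [tri_eq_image_triHomeo hT]
      exact (triHomeo hT).injective.preimage_image _
    rw [← h3, setIntegral_map_equiv, hpre]
    congr 1
    refine setIntegral_congr_fun isClosed_lowerHalf.measurableSet fun p hp => ?_
    simp only [foldPt_of_mem_lowerHalf hp]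
    exact congrArg g (triHomeo_apply hT p)
  have h1 := key (fun _ => 1) continuousOn_const
  have hone : sqInt (fun _ => 1) = 1 := by simp [sqInt]
  rw [hone, setIntegral_const, smul_eq_mul, mul_one, Measure.real] at h1
  rw [← key f hf]
  have hV : (volume (tri A B C)).toReal ≠ 0 := fun h => by simp [h] at h1
  field_simp
  linear_combination (-∫ z in tri A B C, f z) * h1

/-- For every triangle `T ⊂ ℝ²` there exist an infinite sequence of points
in `T` and a constant `C > 0` such that for every `f ∈ C²(T)` with `‖f‖_{C²(T)} ≤ 1` the QMC
error is at most `C (log₂ N)³ / N` for all `N ≥ 2`, and at most `C m² / 2^m` for `N = 2^m`. -/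
theorem statement0 (A B C : Pt) (hT : AffineIndependent ℝ ![A, B, C]) :
    ∃ x : ℕ → Pt, (∀ k, x k ∈ tri A B C) ∧ ∃ Cc : ℝ, 0 < Cc ∧
      ∀ f : Pt → ℝ, ContDiffOn ℝ 2 f (tri A B C) → c2Norm (tri A B C) f ≤ 1 →
        (∀ N : ℕ, 2 ≤ N →
          |(N : ℝ)⁻¹ * ∑ k ∈ Finset.range N, f (x k) -
            (volume (tri A B C)).toReal⁻¹ * ∫ z in tri A B C, f z| ≤
          Cc * (Real.logb 2 N) ^ 3 / N) ∧
        (∀ m : ℕ, 1 ≤ m →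
          |((2 : ℝ) ^ m)⁻¹ * ∑ k ∈ Finset.range (2 ^ m), f (x k) -
            (volume (tri A B C)).toReal⁻¹ * ∫ z in tri A B C, f z| ≤
          Cc * m ^ 2 / 2 ^ m) := by
  refine ⟨fun k => triMap A B C (foldPt (tentPt k)), fun k => ?_, ?_⟩
  · rw [tri_eq_image]
    exact Set.mem_image_of_mem _ (foldPt_mem _)
  set M := ‖triLin A B C‖
  have hM : 0 ≤ M := norm_nonneg _
  set K := 3 * (2 * (2 * M) + 8 * M ^ 2)
  have hK : 0 ≤ K := by positivity
  refine ⟨2 * K + 1, by positivity, fun f hf hn => ?_⟩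
  have main : ∀ m N : ℕ, 0 < N → N < 4 ^ m →
      |(N : ℝ)⁻¹ * ∑ k ∈ Finset.range N, f (triMap A B C (foldPt (tentPt k))) -
        (volume (tri A B C)).toReal⁻¹ * ∫ z in tri A B C, f z| ≤ K * m / N := by
    intro m N hN0 hN
    have hNr : (0 : ℝ) < N := by exact_mod_cast hN0
    have h := (foldBound_comp_triMap hT hf hn).abs_sum_tentPt_sub_le (by positivity)
      (by positivity) (continuous_comp_triMap_foldPt hf.continuousOn) m N hN
    rw [← setAverage_tri hT hf.continuousOn] at h
    rw [le_div_iff₀ hNr]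
    calc _ = |∑ k ∈ Finset.range N, f (triMap A B C (foldPt (tentPt k))) -
        N * ((volume (tri A B C)).toReal⁻¹ * ∫ z in tri A B C, f z)| := by
          nth_rw 2 [← abs_of_pos hNr]
          rw [← abs_mul]
          congr 1
          field_simp
      _ ≤ _ := h
  have lt4 : ∀ {N m : ℕ}, N < 2 ^ m → N < 4 ^ m := fun h =>
    h.trans_le (Nat.pow_le_pow_left (by norm_num) _)
  constructor
  · intro N hN
    have hNr : (2 : ℝ) ≤ N := by exact_mod_cast hN
    refine (main (Nat.log 2 N + 1) N (by omega)
      (lt4 (Nat.lt_pow_succ_log_self (by norm_num) N))).trans ?_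
    have hl1 : 1 ≤ Real.logb 2 N := by
      rw [Real.le_logb_iff_rpow_le (by norm_num) (by linarith)]
      simpa using hNr
    have hl2 : (Nat.log 2 N : ℝ) ≤ Real.logb 2 N := by exact_mod_cast Real.natLog_le_logb N 2
    have hl3 : Real.logb 2 N ≤ Real.logb 2 N ^ 3 := le_self_pow₀ hl1 (by norm_num)
    refine div_le_div_of_nonneg_right ?_ (by positivity)
    push_cast
    calc K * ((Nat.log 2 N : ℝ) + 1) ≤ K * (2 * Real.logb 2 N ^ 3) := by gcongr; linarith
      _ ≤ (2 * K + 1) * Real.logb 2 N ^ 3 := by nlinarith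
  · intro m hm
    have h := main m (2 ^ m) (by positivity) ?_
    · push_cast at h
      refine h.trans ?_
      have hm1 : (1 : ℝ) ≤ m := by exact_mod_cast hm
      gcongr
      · linarith
      · exact le_self_pow₀ hm1 (by norm_num)
    · exact Nat.pow_lt_pow_left (by norm_num) (by omega)
end
end

section
/- Let T ⊂ ℝ² be a triangle, t ∈ ℕ₀, and let C₁,C₂ ∈ 𝔽₂^{ℕ×ℕ} be upper triangular matrices (entries (C_j)_{kl} = 0 for k > l) generating a digital (t,2)-sequence over 𝔽₂, and let the points in T be p_h := φ^{(ν(h))}(X(h)) for h ∈ ℕ₀. Then there exists a constant C > 0 such that for every twice continuously differentiable f : T → ℝ and every integer N ≥ 2, |(1/N)·∑_{h=0}^{N−1} f(p_h) − (1/|T|)·∫_T f(x) dx| ≤ C·‖f‖_{C²(T)}·(log₂ N)³/N. -/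
open MeasureTheory

noncomputable section

section Geometry

/-- The sign of the orientation of the four children of a triangle. -/
def orient (ξ : F2 × F2) : ℝ := if ξ = (0, 0) then -1 else 1

/-- The perimeter of a triangle given by its vertex triple. -/
def perim (v : Pt × Pt × Pt) : ℝ := ‖v.1 - v.2.1‖ + ‖v.1 - v.2.2‖ + ‖v.2.1 - v.2.2‖

theorem sum_F2_prod {M : Type*} [AddCommMonoid M] (φ : F2 × F2 → M) :
    ∑ ξ, φ ξ = φ (0, 0) + φ (0, 1) + (φ (1, 0) + φ (1, 1)) := by
  rw [Fintype.sum_prod_type]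
  exact (Fin.sum_univ_two _).trans
    (congrArg₂ (· + ·) (Fin.sum_univ_two _) (Fin.sum_univ_two _))

theorem F2_prod_cases (ξ : F2 × F2) :
    ξ = (0, 0) ∨ ξ = (0, 1) ∨ ξ = (1, 0) ∨ ξ = (1, 1) := by
  revert ξ; decide

@[simp] theorem subV_zero_zero (v : Pt × Pt × Pt) : subV v (0, 0) =
    ((2:ℝ)⁻¹ • (v.2.1 + v.2.2), (2:ℝ)⁻¹ • (v.2.2 + v.1), (2:ℝ)⁻¹ • (v.1 + v.2.1)) := rfl

@[simp] theorem subV_one_zero (v : Pt × Pt × Pt) : subV v (1, 0) =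
    (v.1, (2:ℝ)⁻¹ • (v.1 + v.2.1), (2:ℝ)⁻¹ • (v.1 + v.2.2)) := rfl

@[simp] theorem subV_zero_one (v : Pt × Pt × Pt) : subV v (0, 1) =
    ((2:ℝ)⁻¹ • (v.2.1 + v.1), v.2.1, (2:ℝ)⁻¹ • (v.2.1 + v.2.2)) := rfl

@[simp] theorem subV_one_one (v : Pt × Pt × Pt) : subV v (1, 1) =
    ((2:ℝ)⁻¹ • (v.2.2 + v.1), (2:ℝ)⁻¹ • (v.2.2 + v.2.1), v.2.2) := rfl

@[simp] theorem orient_zero_zero : orient (0, 0) = -1 := rfl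
@[simp] theorem orient_zero_one : orient (0, 1) = 1 := rfl
@[simp] theorem orient_one_zero : orient (1, 0) = 1 := rfl
@[simp] theorem orient_one_one : orient (1, 1) = 1 := rfl

theorem abs_orient (ξ : F2 × F2) : |orient ξ| = 1 := by
  rcases F2_prod_cases ξ with rfl | rfl | rfl | rfl <;> simp

theorem subV_edge₁ (v : Pt × Pt × Pt) (ξ : F2 × F2) :
    (subV v ξ).1 - (subV v ξ).2.1 = (orient ξ / 2) • (v.1 - v.2.1) := by
  rcases F2_prod_cases ξ with rfl | rfl | rfl | rfl <;> simp <;> module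

theorem subV_edge₂ (v : Pt × Pt × Pt) (ξ : F2 × F2) :
    (subV v ξ).1 - (subV v ξ).2.2 = (orient ξ / 2) • (v.1 - v.2.2) := by
  rcases F2_prod_cases ξ with rfl | rfl | rfl | rfl <;> simp <;> module

theorem subV_edge₃ (v : Pt × Pt × Pt) (ξ : F2 × F2) :
    (subV v ξ).2.1 - (subV v ξ).2.2 = (orient ξ / 2) • (v.2.1 - v.2.2) := by
  rcases F2_prod_cases ξ with rfl | rfl | rfl | rfl <;> simp <;> module

theorem perim_nonneg (v : Pt × Pt × Pt) : 0 ≤ perim v := by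
  unfold perim; positivity

theorem perim_subV (v : Pt × Pt × Pt) (ξ : F2 × F2) : perim (subV v ξ) = perim v / 2 := by
  unfold perim
  rw [subV_edge₁, subV_edge₂, subV_edge₃]
  simp only [norm_smul, norm_div, Real.norm_eq_abs, abs_orient]
  norm_num
  ring

theorem vIter_nil (v : Pt × Pt × Pt) : vIter v [] = v := rfl

theorem vIter_append (v : Pt × Pt × Pt) (l l' : List (F2 × F2)) :
    vIter v (l ++ l') = vIter (vIter v l) l' := List.foldl_append

theorem vIter_concat (v : Pt × Pt × Pt) (l : List (F2 × F2)) (ξ : F2 × F2) :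
    vIter v (l ++ [ξ]) = subV (vIter v l) ξ := vIter_append v l [ξ]

theorem ctr_eq (v : Pt × Pt × Pt) (l : List (F2 × F2)) : ctr v l = ctr (vIter v l) [] := rfl

theorem subTri_eq (v : Pt × Pt × Pt) (l : List (F2 × F2)) :
    subTri v l = subTri (vIter v l) [] := rfl

theorem perim_vIter (l : List (F2 × F2)) (v : Pt × Pt × Pt) :
    perim (vIter v l) = perim v / 2 ^ l.length := by
  induction l generalizing v with
  | nil => simp [vIter_nil]
  | cons ξ l ih =>
    have : vIter v (ξ :: l) = vIter (subV v ξ) l := rfl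
    rw [this, ih, perim_subV, List.length_cons, pow_succ', div_div]

theorem convex_subTri (v : Pt × Pt × Pt) : Convex ℝ (subTri v []) := by
  rintro _ ⟨a, b, c, ha, hb, hc, h, rfl⟩ _ ⟨a', b', c', ha', hb', hc', h', rfl⟩ p q hp hq hpq
  refine ⟨p * a + q * a', p * b + q * b', p * c + q * c', by positivity, by positivity,
    by positivity, ?_, by module⟩
  linear_combination p * h + q * h' + hpq

theorem subTri_eq_convexHull (v : Pt × Pt × Pt) :
    subTri v [] = convexHull ℝ {v.1, v.2.1, v.2.2} := by
  apply Set.Subset.antisymm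
  · rintro _ ⟨a, b, c, ha, hb, hc, h, rfl⟩
    have := (convex_convexHull ℝ ({v.1, v.2.1, v.2.2} : Set Pt)).sum_mem
      (t := Finset.univ) (w := ![a, b, c]) (z := ![v.1, v.2.1, v.2.2])
      (by intro i _; fin_cases i <;> simpa) (by simpa [Fin.sum_univ_three] using h)
      (by intro i _; apply subset_convexHull; fin_cases i <;> simp)
    simpa [Fin.sum_univ_three, vIter_nil] using this
  · refine convexHull_min ?_ (convex_subTri v)
    rintro x (rfl | rfl | rfl)
    · exact ⟨1, 0, 0, by simp [vIter_nil]⟩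
    · exact ⟨0, 1, 0, by simp [vIter_nil]⟩
    · exact ⟨0, 0, 1, by simp [vIter_nil]⟩

theorem isCompact_subTri (v : Pt × Pt × Pt) : IsCompact (subTri v []) := by
  rw [subTri_eq_convexHull]
  exact (Set.toFinite _).isCompact_convexHull ℝ

theorem interior_subTri_nonempty {A B C : Pt} (hT : AffineIndependent ℝ ![A, B, C]) :
    (interior (subTri (A, B, C) [])).Nonempty := by
  rw [subTri_eq_convexHull, interior_convexHull_nonempty_iff_affineSpan_eq_top]
  have := hT.affineSpan_eq_top_iff_card_eq_finrank_add_one.2 (by simp)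
  rw [← this]
  congr 1
  ext x
  simp only [Matrix.range_cons, Matrix.range_empty, Set.union_empty, Set.singleton_union]

theorem subTri_subV_subset (v : Pt × Pt × Pt) (ξ : F2 × F2) :
    subTri (subV v ξ) [] ⊆ subTri v [] := by
  rintro x ⟨a, b, c, ha, hb, hc, h, rfl⟩
  rcases F2_prod_cases ξ with rfl | rfl | rfl | rfl
  · exact ⟨(b + c) / 2, (a + c) / 2, (a + b) / 2, by positivity, by positivity, by positivity,
      by linarith, by simp [vIter_nil]; module⟩
  · exact ⟨a / 2, a / 2 + b + c / 2, c / 2, by positivity, by positivity, by positivity,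
      by linarith, by simp [vIter_nil]; module⟩
  · exact ⟨a + b / 2 + c / 2, b / 2, c / 2, by positivity, by positivity, by positivity,
      by linarith, by simp [vIter_nil]; module⟩
  · exact ⟨a / 2, b / 2, a / 2 + b / 2 + c, by positivity, by positivity, by positivity,
      by linarith, by simp [vIter_nil]; module⟩

theorem subTri_append_subset (v : Pt × Pt × Pt) (l l' : List (F2 × F2)) :
    subTri v (l ++ l') ⊆ subTri v l := by
  induction l' generalizing l with
  | nil => simp
  | cons ξ l' ih =>
    have h := ih (l ++ [ξ])
    rw [List.append_assoc] at h
    refine h.trans ?_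
    rw [subTri_eq, vIter_concat, subTri_eq v l]
    exact subTri_subV_subset _ _

theorem ctr_mem (v : Pt × Pt × Pt) (l : List (F2 × F2)) : ctr v l ∈ subTri v l :=
  ⟨3⁻¹, 3⁻¹, 3⁻¹, by norm_num, by norm_num, by norm_num, by norm_num, by unfold ctr; module⟩

theorem norm_sub_ctr_le {v : Pt × Pt × Pt} {y : Pt} (hy : y ∈ subTri v []) :
    ‖y - ctr v []‖ ≤ perim v := by
  obtain ⟨a, b, c, ha, hb, hc, h, rfl⟩ := hy
  simp only [vIter_nil, ctr]
  have hc' : c = 1 - a - b := by linarith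
  have h1 : a • v.1 + b • v.2.1 + c • v.2.2 - (3:ℝ)⁻¹ • (v.1 + v.2.1 + v.2.2)
      = (a / 3 - b / 3) • (v.1 - v.2.1) + (a / 3 - c / 3) • (v.1 - v.2.2)
        + (b / 3 - c / 3) • (v.2.1 - v.2.2) := by
    subst hc'; module
  rw [h1]
  have key : ∀ (r : ℝ) (x : Pt), |r| ≤ 1 → ‖r • x‖ ≤ ‖x‖ := fun r x hr => by
    rw [norm_smul, Real.norm_eq_abs]
    exact mul_le_of_le_one_left (norm_nonneg _) hr
  refine (norm_add₃_le).trans ?_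
  unfold perim
  gcongr <;> apply key <;> rw [abs_le] <;> constructor <;> linarith

theorem sum_ctr_subV (v : Pt × Pt × Pt) : ∑ ξ, ctr (subV v ξ) [] = (4:ℝ) • ctr v [] := by
  rw [sum_F2_prod]
  simp only [ctr, vIter_nil, subV_zero_zero, subV_one_zero, subV_zero_one, subV_one_one]
  module

theorem ctr_subV_zero (v : Pt × Pt × Pt) : ctr (subV v (0, 0)) [] = ctr v [] := by
  simp only [ctr, vIter_nil, subV_zero_zero]
  module

theorem ctr_subV_sub_ctr (v : Pt × Pt × Pt) (ξ κ : F2 × F2) :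
    ctr (subV (subV v ξ) κ) [] - ctr (subV v ξ) [] =
      (orient ξ / 2) • (ctr (subV v κ) [] - ctr v []) := by
  rcases F2_prod_cases ξ with rfl | rfl | rfl | rfl <;>
  rcases F2_prod_cases κ with rfl | rfl | rfl | rfl <;>
  simp [ctr, vIter_nil] <;> module

end Geometry
section Averages

open scoped Pointwise

/-- The average of `φ` over the centres of the `4 ^ j` descendants of level `j`. -/
def lvlAvg (φ : Pt → ℝ) : ℕ → Pt × Pt × Pt → ℝ
  | 0, v => φ (ctr v [])
  | j + 1, v => (∑ ξ, lvlAvg φ j (subV v ξ)) / 4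

theorem abs_lvlAvg_sub_le {φ : Pt → ℝ} {a ε : ℝ} (L : Pt →L[ℝ] ℝ) (j : ℕ) (v : Pt × Pt × Pt)
    (h : ∀ y ∈ subTri v [], |φ y - a - L y| ≤ ε) :
    |lvlAvg φ j v - a - L (ctr v [])| ≤ ε := by
  induction j generalizing v with
  | zero => exact h _ (ctr_mem v [])
  | succ j ih =>
    have hs : ∑ ξ, (lvlAvg φ j (subV v ξ) - a - L (ctr (subV v ξ) []))
        = 4 * (lvlAvg φ (j + 1) v - a - L (ctr v [])) := by
      rw [Finset.sum_sub_distrib, Finset.sum_sub_distrib, ← map_sum, sum_ctr_subV, lvlAvg]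
      simp
      ring
    have hb : |∑ ξ, (lvlAvg φ j (subV v ξ) - a - L (ctr (subV v ξ) []))| ≤ 4 * ε := by
      refine (Finset.abs_sum_le_sum_abs _ _).trans ?_
      refine (Finset.sum_le_card_nsmul _ _ ε fun ξ _ =>
        ih _ fun y hy => h y (subTri_subV_subset v ξ hy)).trans ?_
      simp
    rw [hs, abs_mul, abs_of_pos (by norm_num : (0:ℝ) < 4)] at hb
    linarith

theorem subTri_subset_iUnion (v : Pt × Pt × Pt) :
    subTri v [] ⊆ ⋃ ξ, subTri (subV v ξ) [] := by
  rintro x ⟨a, b, c, ha, hb, hc, h, rfl⟩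
  rw [Set.mem_iUnion]
  have hc' : c = 1 - a - b := by linarith
  by_cases h1 : 1 / 2 ≤ a
  · exact ⟨(1, 0), 2 * a - 1, 2 * b, 2 * c, by linarith, by linarith, by linarith, by linarith,
      by simp only [vIter_nil, subV_one_zero]; subst hc'; module⟩
  by_cases h2 : 1 / 2 ≤ b
  · exact ⟨(0, 1), 2 * a, 2 * b - 1, 2 * c, by linarith, by linarith, by linarith, by linarith,
      by simp only [vIter_nil, subV_zero_one]; subst hc'; module⟩
  by_cases h3 : 1 / 2 ≤ c
  · exact ⟨(1, 1), 2 * a, 2 * b, 2 * c - 1, by linarith, by linarith, by linarith, by linarith,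
      by simp only [vIter_nil, subV_one_one]; subst hc'; module⟩
  · exact ⟨(0, 0), 1 - 2 * a, 1 - 2 * b, 1 - 2 * c, by linarith, by linarith, by linarith,
      by linarith, by simp only [vIter_nil, subV_zero_zero]; subst hc'; module⟩

theorem subTri_subV_eq_image (v : Pt × Pt × Pt) (ξ : F2 × F2) :
    subTri (subV v ξ) [] = (fun x : Pt => (ctr (subV v ξ) [] - (orient ξ / 2) • ctr v []) + x) ''
      ((orient ξ / 2) • subTri v []) := by
  have key : ∀ a b c : ℝ, a + b + c = 1 →
      a • (subV v ξ).1 + b • (subV v ξ).2.1 + c • (subV v ξ).2.2 =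
      (ctr (subV v ξ) [] - (orient ξ / 2) • ctr v []) +
        (orient ξ / 2) • (a • v.1 + b • v.2.1 + c • v.2.2) := by
    intro a b c h
    have hc : c = 1 - a - b := by linarith
    subst hc
    rcases F2_prod_cases ξ with rfl | rfl | rfl | rfl <;>
    simp [ctr, vIter_nil] <;> module
  ext x
  constructor
  · rintro ⟨a, b, c, ha, hb, hc, h, rfl⟩
    exact ⟨_, Set.smul_mem_smul_set ⟨a, b, c, ha, hb, hc, h, rfl⟩, (key a b c h).symm⟩
  · rintro ⟨_, ⟨_, ⟨a, b, c, ha, hb, hc, h, rfl⟩, rfl⟩, rfl⟩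
    exact ⟨a, b, c, ha, hb, hc, h, (key a b c h).symm⟩

theorem volume_subTri_subV (v : Pt × Pt × Pt) (ξ : F2 × F2) :
    volume (subTri (subV v ξ) []) = ENNReal.ofReal 4⁻¹ * volume (subTri v []) := by
  rw [subTri_subV_eq_image, Set.image_add_left, measure_preimage_add, Measure.addHaar_smul]
  congr 2
  rw [finrank_euclideanSpace_fin, abs_pow, abs_div, abs_orient]
  norm_num

theorem volume_subTri_ne_top (v : Pt × Pt × Pt) : volume (subTri v []) ≠ ⊤ :=
  (isCompact_subTri v).measure_lt_top.ne

theorem restrict_subTri_eq_sum (v : Pt × Pt × Pt) :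
    (volume : Measure Pt).restrict (subTri v []) =
      Measure.sum fun ξ => (volume : Measure Pt).restrict (subTri (subV v ξ) []) := by
  have : IsFiniteMeasure ((volume : Measure Pt).restrict (subTri v [])) :=
    ⟨by simpa using (isCompact_subTri v).measure_lt_top⟩
  refine Measure.eq_of_le_of_measure_univ_eq ?_ ?_
  · exact (Measure.restrict_mono (subTri_subset_iUnion v) le_rfl).trans
      Measure.restrict_iUnion_le
  · rw [Measure.sum_apply _ MeasurableSet.univ, tsum_fintype, sum_F2_prod]
    simp only [Measure.restrict_apply_univ, volume_subTri_subV]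
    rw [← add_mul, ← add_mul, ← ENNReal.ofReal_add, ← ENNReal.ofReal_add] <;> norm_num

theorem abs_integral_sub_lvlAvg_le {φ : Pt → ℝ} {K : ℝ} (hK : 0 ≤ K) (j : ℕ)
    (v : Pt × Pt × Pt) (hφ : ContinuousOn φ (subTri v []))
    (h : ∀ x ∈ subTri v [], ∀ y ∈ subTri v [], |φ x - φ y| ≤ K * ‖x - y‖) :
    |(∫ x in subTri v [], φ x) - (volume (subTri v [])).toReal * lvlAvg φ j v| ≤
      (volume (subTri v [])).toReal * (K * perim v / 2 ^ j) := by
  induction j generalizing v with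
  | zero =>
    have hfin := volume_subTri_ne_top v
    have hint : IntegrableOn φ (subTri v []) := hφ.integrableOn_compact (isCompact_subTri v)
    have e : (∫ x in subTri v [], φ x) - (volume (subTri v [])).toReal * lvlAvg φ 0 v =
        ∫ x in subTri v [], (φ x - φ (ctr v [])) := by
      rw [integral_sub hint (integrableOn_const hfin), setIntegral_const]
      rfl
    rw [e]
    have := norm_setIntegral_le_of_norm_le_const (μ := volume) (s := subTri v [])
      (f := fun x => φ x - φ (ctr v [])) (C := K * perim v) hfin.lt_top fun x hx =>
        (h x hx _ (ctr_mem v [])).trans (by gcongr; exact norm_sub_ctr_le hx)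
    rw [Real.norm_eq_abs] at this
    refine this.trans (le_of_eq ?_)
    rw [pow_zero, div_one, mul_comm]
    rfl
  | succ j ih =>
    have hint : ∀ ξ, IntegrableOn φ (subTri (subV v ξ) []) := fun ξ =>
      (hφ.mono (subTri_subV_subset v ξ)).integrableOn_compact (isCompact_subTri _)
    have hv : ∀ ξ, (volume (subTri (subV v ξ) [])).toReal =
        (volume (subTri v [])).toReal / 4 := fun ξ => by
      rw [volume_subTri_subV, ENNReal.toReal_mul, ENNReal.toReal_ofReal (by norm_num)]
      ring
    have e : (∫ x in subTri v [], φ x) - (volume (subTri v [])).toReal * lvlAvg φ (j + 1) v =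
        ∑ ξ, ((∫ x in subTri (subV v ξ) [], φ x) -
          (volume (subTri (subV v ξ) [])).toReal * lvlAvg φ j (subV v ξ)) := by
      rw [restrict_subTri_eq_sum, Measure.sum_fintype,
        integral_finsetSum_measure fun ξ _ => hint ξ, Finset.sum_sub_distrib]
      simp only [hv, ← Finset.mul_sum, lvlAvg]
      ring
    rw [e]
    refine (Finset.abs_sum_le_sum_abs _ _).trans ?_
    refine (Finset.sum_le_sum fun ξ _ => ih (subV v ξ) (hφ.mono (subTri_subV_subset v ξ))
      fun x hx y hy => h x (subTri_subV_subset v ξ hx) y (subTri_subV_subset v ξ hy)).trans ?_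
    simp only [hv, perim_subV, sum_F2_prod]
    apply le_of_eq
    rw [pow_succ]
    ring

end Averages
section Walsh

theorem F2_cases (x : F2) : x = 0 ∨ x = 1 := by revert x; decide

theorem neg_one_pow_val_add (x y : F2) :
    (-1 : ℝ) ^ (x + y).val = (-1) ^ x.val * (-1) ^ y.val := by
  rcases F2_cases x with rfl | rfl <;> rcases F2_cases y with rfl | rfl
  · simp
  · simp
  · simp
  · rw [show (1 + 1 : F2) = 0 from rfl, ZMod.val_one, ZMod.val_zero]; norm_num

theorem walRow_add_right (κ ξ ξ' : F2 × F2) :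
    walRow κ (ξ + ξ') = walRow κ ξ * walRow κ ξ' := by
  unfold walRow
  rw [← neg_one_pow_val_add]
  congr 2
  simp only [Prod.fst_add, Prod.snd_add]
  ring

theorem walRow_comm (κ ξ : F2 × F2) : walRow κ ξ = walRow ξ κ := by
  unfold walRow
  rw [mul_comm κ.1, mul_comm κ.2]

theorem abs_walRow (κ ξ : F2 × F2) : |walRow κ ξ| = 1 := by
  simp [walRow, abs_pow]

@[simp] theorem walRow_zero_left (ξ : F2 × F2) : walRow (0, 0) ξ = 1 := by
  simp [walRow]

theorem walRow_values : walRow (0, 1) (0, 0) = 1 ∧ walRow (0, 1) (0, 1) = -1 ∧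
    walRow (0, 1) (1, 0) = 1 ∧ walRow (0, 1) (1, 1) = -1 ∧
    walRow (1, 0) (0, 0) = 1 ∧ walRow (1, 0) (0, 1) = 1 ∧
    walRow (1, 0) (1, 0) = -1 ∧ walRow (1, 0) (1, 1) = -1 ∧
    walRow (1, 1) (0, 0) = 1 ∧ walRow (1, 1) (0, 1) = -1 ∧
    walRow (1, 1) (1, 0) = -1 ∧ walRow (1, 1) (1, 1) = 1 := by
  simp [walRow, ZMod.val_one, show (1 + 1 : F2) = 0 from rfl]

theorem sum_walRow (κ : F2 × F2) : ∑ ξ, walRow ξ κ = if κ = 0 then 4 else 0 := by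
  have h := walRow_values
  simp only [walRow_comm _ κ, sum_F2_prod]
  rcases F2_prod_cases κ with rfl | rfl | rfl | rfl
  · simp; norm_num
  all_goals simp [h]

theorem abs_sum_walRow_mul_orient (κ : F2 × F2) : |∑ ξ, walRow κ ξ * orient ξ| = 2 := by
  have h := walRow_values
  rw [sum_F2_prod]
  rcases F2_prod_cases κ with rfl | rfl | rfl | rfl
  all_goals simp [h]
  all_goals norm_num

/-- The Walsh function with index `K`, as a product over the rows. -/
def wal {n : ℕ} (K X : Fin n → F2 × F2) : ℝ := ∏ i, walRow (K i) (X i)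

theorem abs_wal {n : ℕ} (K X : Fin n → F2 × F2) : |wal K X| = 1 := by
  simp [wal, Finset.abs_prod, abs_walRow]

theorem wal_add_right {n : ℕ} (K X Y : Fin n → F2 × F2) :
    wal K (X + Y) = wal K X * wal K Y := by
  simp [wal, walRow_add_right, Finset.prod_mul_distrib]

theorem wal_eq {n : ℕ} (K X : Fin n → F2 × F2) :
    wal K X = (-1 : ℝ) ^ (∑ i, ((K i).1 * (X i).1 + (K i).2 * (X i).2)).val := by
  unfold wal walRow
  induction (Finset.univ : Finset (Fin n)) using Finset.cons_induction with
  | empty => simp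
  | cons i s hi ih => rw [Finset.prod_cons, Finset.sum_cons, neg_one_pow_val_add (_ + _), ih]

theorem F2_prod_add_eq_zero (x y : F2 × F2) : x + y = 0 ↔ x = y := by
  revert x y; decide

theorem sum_wal_mul_wal {n : ℕ} (X Y : Fin n → F2 × F2) :
    ∑ K, wal K X * wal K Y = if X = Y then 4 ^ n else 0 := by
  have h : ∑ K, wal K X * wal K Y = ∏ i, ∑ κ, walRow κ (X i + Y i) := by
    rw [Finset.prod_univ_sum, Fintype.piFinset_univ]
    exact Finset.sum_congr rfl fun K _ => (wal_add_right K X Y).symm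
  rw [h]
  simp only [sum_walRow, F2_prod_add_eq_zero]
  split_ifs with hXY
  · subst hXY; simp
  · obtain ⟨i, hi⟩ := Function.ne_iff.1 hXY
    exact Finset.prod_eq_zero (Finset.mem_univ i) (by simp [hi])

theorem walsh_inversion {n : ℕ} (G : (Fin n → F2 × F2) → ℝ) (Y : Fin n → F2 × F2) :
    4 ^ n * G Y = ∑ K, (∑ X, G X * wal K X) * wal K Y := by
  simp only [Finset.sum_mul]
  rw [Finset.sum_comm]
  simp only [mul_assoc, ← Finset.mul_sum, sum_wal_mul_wal]
  simp [mul_comm]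

theorem sum_snoc {α M : Type*} [Fintype α] [AddCommMonoid M] {n : ℕ}
    (F : (Fin (n + 1) → α) → M) :
    ∑ X, F X = ∑ X : Fin n → α, ∑ ξ, F (Fin.snoc X ξ) := by
  rw [← (Fin.snocEquiv fun _ => α).sum_comp, Fintype.sum_prod_type_right]
  rfl

theorem ofFn_snoc {α : Type*} {n : ℕ} (X : Fin n → α) (ξ : α) :
    List.ofFn (Fin.snoc X ξ : Fin (n + 1) → α) = List.ofFn X ++ [ξ] := by
  rw [List.ofFn_succ']
  simp

theorem wal_snoc {n : ℕ} (K : Fin (n + 1) → F2 × F2) (X : Fin n → F2 × F2) (ξ : F2 × F2) :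
    wal K (Fin.snoc X ξ) = wal (fun i => K i.castSucc) X * walRow (K (Fin.last n)) ξ := by
  simp [wal, Fin.prod_univ_castSucc]

theorem card_rows (n : ℕ) : Fintype.card (Fin n → F2 × F2) = 4 ^ n := by
  simp

theorem abs_sum_wal_mul_le {v : Pt × Pt × Pt} {g : Pt → Pt →L[ℝ] ℝ} {Q : ℝ}
    (hg : ∀ x ∈ subTri v [], ‖g x‖ ≤ Q)
    (hlip : ∀ x ∈ subTri v [], ∀ y ∈ subTri v [], ‖g x - g y‖ ≤ Q * ‖x - y‖)
    {d : Pt × Pt × Pt → Pt} (hd : ∀ w ξ, d (subV w ξ) = (orient ξ / 2) • d w)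
    (hdn : ∀ w, ‖d w‖ ≤ 4 * perim w) {n : ℕ} (K : Fin n → F2 × F2) :
    |∑ X, wal K X * g (ctr v (List.ofFn X)) (d (vIter v (List.ofFn X)))| ≤
      4 * Q * perim v + 8 * n * Q * perim v ^ 2 := by
  have hs := perim_nonneg v
  have hQ : 0 ≤ Q := (norm_nonneg _).trans (hg _ (ctr_mem v []))
  induction n with
  | zero =>
    simp only [wal, Finset.univ_eq_empty, Finset.prod_empty, one_mul, List.ofFn_zero,
      Finset.univ_unique, Finset.sum_const, Finset.card_singleton, one_smul, CharP.cast_eq_zero,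
      mul_zero, zero_mul, add_zero]
    refine ((g _).le_opNorm _).trans ?_
    calc _ ≤ Q * (4 * perim v) := mul_le_mul (hg _ (ctr_mem v [])) (hdn v) (norm_nonneg _) hQ
      _ = _ := by ring
  | succ n ih =>
    have hX : ∀ X : Fin n → F2 × F2, |∑ ξ, wal K (Fin.snoc X ξ) *
          g (ctr v (List.ofFn (Fin.snoc X ξ : Fin (n + 1) → F2 × F2)))
            (d (vIter v (List.ofFn (Fin.snoc X ξ : Fin (n + 1) → F2 × F2)))) -
        wal (fun i => K i.castSucc) X * (g (ctr v (List.ofFn X)) (d (vIter v (List.ofFn X))) *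
          ((∑ ξ, walRow (K (Fin.last n)) ξ * orient ξ) / 2))| ≤
        8 * Q * perim v ^ 2 / 4 ^ n := by
      intro X
      set V := vIter v (List.ofFn X) with hV
      have hVp : perim V = perim v / 2 ^ n := by rw [hV, perim_vIter, List.length_ofFn]
      have hsub : subTri V [] ⊆ subTri v [] := subTri_append_subset v [] (List.ofFn X)
      have e : ∑ ξ, wal K (Fin.snoc X ξ) *
          g (ctr v (List.ofFn (Fin.snoc X ξ : Fin (n + 1) → F2 × F2)))
            (d (vIter v (List.ofFn (Fin.snoc X ξ : Fin (n + 1) → F2 × F2)))) -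
        wal (fun i => K i.castSucc) X * (g (ctr v (List.ofFn X)) (d V) *
          ((∑ ξ, walRow (K (Fin.last n)) ξ * orient ξ) / 2)) =
          ∑ ξ, (wal (fun i => K i.castSucc) X * walRow (K (Fin.last n)) ξ * orient ξ / 2) *
            (g (ctr (subV V ξ) []) - g (ctr V [])) (d V) := by
        simp only [wal_snoc, ofFn_snoc, vIter_concat, ctr_eq v, hd, ← hV, map_smul, smul_eq_mul,
          sub_apply, Finset.sum_div, Finset.mul_sum,
          ← Finset.sum_sub_distrib]
        refine Finset.sum_congr rfl fun ξ _ => ?_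
        ring
      rw [e]
      refine (Finset.abs_sum_le_sum_abs _ _).trans ?_
      have hξ : ∀ ξ ∈ (Finset.univ : Finset (F2 × F2)),
          |(wal (fun i => K i.castSucc) X * walRow (K (Fin.last n)) ξ * orient ξ / 2) *
            (g (ctr (subV V ξ) []) - g (ctr V [])) (d V)| ≤
          2 * Q * (perim v / 2 ^ n) ^ 2 := by
        intro ξ _
        rw [abs_mul, abs_div, abs_mul, abs_mul, abs_wal, abs_walRow, abs_orient, ← hVp]
        have hc : ctr (subV V ξ) [] ∈ subTri V [] := subTri_subV_subset V ξ (ctr_mem _ _)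
        have h1 : |(g (ctr (subV V ξ) []) - g (ctr V [])) (d V)| ≤
            (Q * perim V) * (4 * perim V) := by
          refine ((g (ctr (subV V ξ) []) - g (ctr V [])).le_opNorm (d V)).trans ?_
          refine mul_le_mul ?_ (hdn V) (norm_nonneg _) (mul_nonneg hQ (perim_nonneg V))
          refine (hlip _ (hsub hc) _ (hsub (ctr_mem V []))).trans ?_
          gcongr
          exact norm_sub_ctr_le hc
        rw [mul_one, mul_one, abs_two]
        linarith
      refine (Finset.sum_le_card_nsmul _ _ _ hξ).trans (le_of_eq ?_)
      have h4 : ((2:ℝ) ^ n) ^ 2 = 4 ^ n := by rw [← pow_mul, mul_comm, pow_mul]; norm_num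
      simp [div_pow, h4]
      ring
    rw [sum_snoc]
    have hsum := (Finset.abs_sum_le_sum_abs (fun X : Fin n → F2 × F2 => _) Finset.univ).trans
      (Finset.sum_le_card_nsmul _ _ _ fun X _ => hX X)
    rw [Finset.sum_sub_distrib, Finset.card_univ, card_rows, nsmul_eq_mul] at hsum
    simp only [← mul_assoc (wal _ _), ← Finset.sum_mul] at hsum
    have h2 := abs_sum_walRow_mul_orient (K (Fin.last n))
    have h3 := ih fun i => K i.castSucc
    have h4 : ((4 ^ n : ℕ) : ℝ) * (8 * Q * perim v ^ 2 / 4 ^ n) = 8 * Q * perim v ^ 2 := by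
      push_cast; field_simp
    rw [h4] at hsum
    have h5 := (abs_sub_abs_le_abs_sub _ _).trans hsum
    rw [abs_mul, abs_div, h2, abs_two, div_self two_ne_zero, mul_one] at h5
    push_cast
    linarith

end Walsh
section Coefficients

/-- The difference of the averages of `φ` over descendants at two consecutive levels. -/
def levelDiff (φ : Pt → ℝ) (v : Pt × Pt × Pt) (j : ℕ) {n : ℕ} (X : Fin (n + 1) → F2 × F2) : ℝ :=
  lvlAvg φ j (vIter v (List.ofFn X)) -
    lvlAvg φ (j + 1) (vIter v (List.ofFn fun i : Fin n => X i.castSucc))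

theorem levelDiff_snoc (φ : Pt → ℝ) (v : Pt × Pt × Pt) (j : ℕ) {n : ℕ} (X : Fin n → F2 × F2)
    (ξ : F2 × F2) :
    levelDiff φ v j (Fin.snoc X ξ : Fin (n + 1) → F2 × F2) =
      lvlAvg φ j (subV (vIter v (List.ofFn X)) ξ) -
        lvlAvg φ (j + 1) (vIter v (List.ofFn X)) := by
  unfold levelDiff
  rw [ofFn_snoc, vIter_concat]
  simp only [Fin.snoc_castSucc]

theorem sum_levelDiff (φ : Pt → ℝ) (v : Pt × Pt × Pt) (j n : ℕ) :
    ∑ X : Fin (n + 1) → F2 × F2, levelDiff φ v j X = 0 := by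
  rw [sum_snoc]
  refine Finset.sum_eq_zero fun X _ => ?_
  simp only [levelDiff_snoc, Finset.sum_sub_distrib, lvlAvg]
  simp
  ring

/-- The Walsh-weighted sum of the displacements of the centres of the children. -/
def childDir (κ : F2 × F2) (v : Pt × Pt × Pt) : Pt :=
  ∑ ξ, walRow κ ξ • (ctr (subV v ξ) [] - ctr v [])

theorem childDir_subV (κ : F2 × F2) (v : Pt × Pt × Pt) (ξ : F2 × F2) :
    childDir κ (subV v ξ) = (orient ξ / 2) • childDir κ v := by
  simp only [childDir, ctr_subV_sub_ctr v ξ, Finset.smul_sum]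
  exact Finset.sum_congr rfl fun _ _ => smul_comm _ _ _

theorem norm_childDir_le (κ : F2 × F2) (v : Pt × Pt × Pt) : ‖childDir κ v‖ ≤ 4 * perim v := by
  refine (norm_sum_le _ _).trans ?_
  refine (Finset.sum_le_card_nsmul _ _ (perim v) fun ξ _ => ?_).trans (le_of_eq (by simp))
  rw [norm_smul, Real.norm_eq_abs, abs_walRow, one_mul]
  exact norm_sub_ctr_le (subTri_subV_subset v ξ (ctr_mem _ _))

/-- First-order control of `φ` on a triangle by a Lipschitz derivative `g`, with all constants
bounded by `Q`. -/
structure TaylorBound (φ : Pt → ℝ) (g : Pt → Pt →L[ℝ] ℝ) (Q : ℝ) (s : Set Pt) : Prop where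
  norm_le : ∀ x ∈ s, ‖g x‖ ≤ Q
  lipschitz_deriv : ∀ x ∈ s, ∀ y ∈ s, ‖g x - g y‖ ≤ Q * ‖x - y‖
  lipschitz : ∀ x ∈ s, ∀ y ∈ s, |φ x - φ y| ≤ Q * ‖x - y‖
  taylor : ∀ x ∈ s, ∀ y ∈ s, |φ y - φ x - g x (y - x)| ≤ Q * ‖y - x‖ ^ 2

theorem abs_sum_walRow_mul_lvlAvg_sub_le {φ : Pt → ℝ} {g : Pt → Pt →L[ℝ] ℝ} {Q : ℝ}
    (hQ : 0 ≤ Q) {v : Pt × Pt × Pt} (h : TaylorBound φ g Q (subTri v [])) (j : ℕ)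
    (κ : F2 × F2) :
    |∑ ξ, walRow κ ξ * (lvlAvg φ j (subV v ξ) - lvlAvg φ (j + 1) v) -
      g (ctr v []) (childDir κ v)| ≤ 8 * Q * perim v ^ 2 := by
  set c := ctr v [] with hc
  have hcm : c ∈ subTri v [] := ctr_mem v []
  have hT : ∀ y ∈ subTri v [], |φ y - (φ c - g c c) - g c y| ≤ Q * perim v ^ 2 := by
    intro y hy
    have := h.taylor c hcm y hy
    rw [map_sub] at this
    rw [show φ y - (φ c - g c c) - g c y = φ y - φ c - (g c y - g c c) by ring]
    refine this.trans ?_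
    gcongr
    exact norm_sub_ctr_le hy
  have h1 := abs_lvlAvg_sub_le (g c) (j + 1) v hT
  have h2 := fun ξ => abs_lvlAvg_sub_le (g c) j (subV v ξ)
    fun y hy => hT y (subTri_subV_subset v ξ hy)
  have e : ∑ ξ, walRow κ ξ * (lvlAvg φ j (subV v ξ) - lvlAvg φ (j + 1) v) - g c (childDir κ v) =
      ∑ ξ, walRow κ ξ * ((lvlAvg φ j (subV v ξ) - (φ c - g c c) - g c (ctr (subV v ξ) [])) -
        (lvlAvg φ (j + 1) v - (φ c - g c c) - g c (ctr v []))) := by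
    simp only [childDir, map_sum, map_smul, smul_eq_mul, map_sub, ← Finset.sum_sub_distrib, ← hc]
    refine Finset.sum_congr rfl fun ξ _ => ?_
    ring
  rw [e]
  refine (Finset.abs_sum_le_sum_abs _ _).trans ?_
  refine (Finset.sum_le_card_nsmul _ _ (2 * Q * perim v ^ 2) fun ξ _ => ?_).trans
    (le_of_eq (by simp; ring))
  rw [abs_mul, abs_walRow, one_mul]
  refine (abs_sub _ _).trans ?_
  linarith [h2 ξ]

theorem abs_walsh_coefficient_levelDiff_le {φ : Pt → ℝ} {g : Pt → Pt →L[ℝ] ℝ} {Q : ℝ}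
    {v : Pt × Pt × Pt} (h : TaylorBound φ g Q (subTri v [])) (j : ℕ) {n : ℕ}
    (K : Fin (n + 1) → F2 × F2) :
    |∑ X, levelDiff φ v j X * wal K X| ≤
      4 * Q * perim v + 8 * n * Q * perim v ^ 2 + 8 * Q * perim v ^ 2 := by
  have hQ : 0 ≤ Q := (norm_nonneg _).trans (h.norm_le _ (ctr_mem v []))
  set K' : Fin n → F2 × F2 := fun i => K i.castSucc
  set κ := K (Fin.last n)
  have hmain := abs_sum_wal_mul_le h.norm_le h.lipschitz_deriv (childDir_subV κ)
    (norm_childDir_le κ) K'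
  have hX : ∀ X : Fin n → F2 × F2,
      |∑ ξ, levelDiff φ v j (Fin.snoc X ξ : Fin (n + 1) → F2 × F2) * wal K (Fin.snoc X ξ) -
        wal K' X * g (ctr v (List.ofFn X)) (childDir κ (vIter v (List.ofFn X)))| ≤
        8 * Q * perim v ^ 2 / 4 ^ n := by
    intro X
    set V := vIter v (List.ofFn X) with hV
    have hVp : perim V = perim v / 2 ^ n := by rw [hV, perim_vIter, List.length_ofFn]
    have hsub : subTri V [] ⊆ subTri v [] := subTri_append_subset v [] (List.ofFn X)
    have hVT : TaylorBound φ g Q (subTri V []) :=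
      ⟨fun x hx => h.norm_le x (hsub hx),
        fun x hx y hy => h.lipschitz_deriv x (hsub hx) y (hsub hy),
        fun x hx y hy => h.lipschitz x (hsub hx) y (hsub hy),
        fun x hx y hy => h.taylor x (hsub hx) y (hsub hy)⟩
    have e : ∑ ξ, levelDiff φ v j (Fin.snoc X ξ : Fin (n + 1) → F2 × F2) * wal K (Fin.snoc X ξ) -
        wal K' X * g (ctr v (List.ofFn X)) (childDir κ V) =
        wal K' X * (∑ ξ, walRow κ ξ * (lvlAvg φ j (subV V ξ) - lvlAvg φ (j + 1) V) -
          g (ctr V []) (childDir κ V)) := by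
      rw [mul_sub, Finset.mul_sum, ctr_eq v]
      congr 1
      refine Finset.sum_congr rfl fun ξ _ => ?_
      rw [levelDiff_snoc, wal_snoc]
      ring
    rw [e, abs_mul, abs_wal, one_mul]
    refine (abs_sum_walRow_mul_lvlAvg_sub_le hQ hVT j κ).trans (le_of_eq ?_)
    have h4 : ((2:ℝ) ^ n) ^ 2 = 4 ^ n := by rw [← pow_mul, mul_comm, pow_mul]; norm_num
    rw [hVp, div_pow, h4, mul_div_assoc]
  have hsum := (Finset.abs_sum_le_sum_abs (fun X : Fin n → F2 × F2 => _) Finset.univ).trans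
    (Finset.sum_le_card_nsmul _ _ _ fun X _ => hX X)
  rw [Finset.sum_sub_distrib, Finset.card_univ, card_rows, nsmul_eq_mul,
    ← sum_snoc (fun X : Fin (n + 1) → F2 × F2 => levelDiff φ v j X * wal K X)] at hsum
  have h4 : ((4 ^ n : ℕ) : ℝ) * (8 * Q * perim v ^ 2 / 4 ^ n) = 8 * Q * perim v ^ 2 := by
    push_cast; field_simp
  rw [h4] at hsum
  linarith [abs_sub_abs_le_abs_sub (∑ X, levelDiff φ v j X * wal K X)
    (∑ X, wal K' X * g (ctr v (List.ofFn X)) (childDir κ (vIter v (List.ofFn X))))]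

end Coefficients

section SecondOrder

theorem abs_le_supAbs {T : Set Pt} (hT : IsCompact T) {g : Pt → ℝ} (hg : ContinuousOn g T)
    {x : Pt} (hx : x ∈ T) : |g x| ≤ supAbs T g := by
  obtain ⟨M, hM⟩ := hT.exists_bound_of_continuousOn hg
  have hM0 : 0 ≤ M := (norm_nonneg _).trans (hM x hx)
  refine le_ciSup_of_le ⟨M, ?_⟩ x (by rw [ciSup_pos hx])
  rintro _ ⟨y, rfl⟩
  exact Real.iSup_le (fun hy => hM y hy) hM0

theorem opNorm_le_of_dirs {G : Type*} [NormedAddCommGroup G] [NormedSpace ℝ G] (L : Pt →L[ℝ] G)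
    {a b : ℝ} (h1 : ‖L dir1‖ ≤ a) (h2 : ‖L dir2‖ ≤ b) : ‖L‖ ≤ a + b := by
  have ha := (norm_nonneg _).trans h1
  have hb := (norm_nonneg _).trans h2
  refine L.opNorm_le_bound (by positivity) fun x => ?_
  have hx : x = x 0 • dir1 + x 1 • dir2 := by
    ext i
    fin_cases i <;> simp [dir1, dir2]
  have e : L x = x 0 • L dir1 + x 1 • L dir2 := by
    conv_lhs => rw [hx]
    simp
  rw [e, add_mul]
  refine (norm_add_le _ _).trans ?_
  rw [norm_smul, norm_smul, mul_comm a, mul_comm b]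
  gcongr
  · exact PiLp.norm_apply_le x 0
  · exact PiLp.norm_apply_le x 1

theorem pdW_pdW_eq {T : Set Pt} {f : Pt → ℝ} {x : Pt} (hT : UniqueDiffWithinAt ℝ T x) (v w : Pt)
    (h : DifferentiableWithinAt ℝ (fderivWithin ℝ f T) T x) :
    pdW T w (pdW T v f) x = fderivWithin ℝ (fderivWithin ℝ f T) T x w v := by
  have := ((ContinuousLinearMap.apply ℝ ℝ v).hasFDerivAt.comp_hasFDerivWithinAt x
    h.hasFDerivWithinAt).fderivWithin hT
  have e : pdW T v f = (ContinuousLinearMap.apply ℝ ℝ v) ∘ fderivWithin ℝ f T := rfl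
  rw [e, pdW, this]
  rfl

theorem c2Norm_nonneg (T : Set Pt) (f : Pt → ℝ) : 0 ≤ c2Norm T f :=
  le_max_of_le_left (Real.iSup_nonneg fun _ => Real.iSup_nonneg fun _ => abs_nonneg _)

theorem supAbs_le_c2Norm (T : Set Pt) (f : Pt → ℝ) :
    supAbs T (pdW T dir1 f) ≤ c2Norm T f ∧ supAbs T (pdW T dir2 f) ≤ c2Norm T f ∧
    supAbs T (pdW T dir1 (pdW T dir1 f)) ≤ c2Norm T f ∧
    supAbs T (pdW T dir2 (pdW T dir1 f)) ≤ c2Norm T f ∧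
    supAbs T (pdW T dir2 (pdW T dir2 f)) ≤ c2Norm T f := by
  simp [c2Norm]

theorem taylorBound_of_contDiffOn {T : Set Pt} (hc : IsCompact T) (hconv : Convex ℝ T)
    (hint : (interior T).Nonempty) {f : Pt → ℝ} (hf : ContDiffOn ℝ 2 f T) :
    TaylorBound f (fderivWithin ℝ f T) (4 * c2Norm T f) T := by
  set c := c2Norm T f with hcdef
  have hc0 : 0 ≤ c := c2Norm_nonneg T f
  have hu : UniqueDiffOn ℝ T := uniqueDiffOn_convex hconv hint
  set g := fderivWithin ℝ f T with hg
  have hg1 : ContDiffOn ℝ 1 g T := hf.fderivWithin hu (by norm_num)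
  have hgd : DifferentiableOn ℝ g T := hg1.differentiableOn (by norm_num)
  have hD : ContinuousOn (fderivWithin ℝ g T) T := hg1.continuousOn_fderivWithin hu (by norm_num)
  obtain ⟨h1, h2, h11, h21, h22⟩ := supAbs_le_c2Norm T f
  have first : ∀ v, supAbs T (pdW T v f) ≤ c → ∀ x ∈ T, ‖g x v‖ ≤ c := fun v hv x hx =>
    (abs_le_supAbs hc (g := pdW T v f)
      (hg1.continuousOn.clm_apply continuousOn_const) hx).trans hv
  have second : ∀ v w, supAbs T (pdW T w (pdW T v f)) ≤ c → ∀ x ∈ T,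
      ‖fderivWithin ℝ g T x w v‖ ≤ c := by
    intro v w hvw x hx
    have e : ∀ y ∈ T, pdW T w (pdW T v f) y = fderivWithin ℝ g T y w v := fun y hy =>
      pdW_pdW_eq (hu y hy) v w (hgd y hy)
    rw [← e x hx]
    refine (abs_le_supAbs hc (ContinuousOn.congr ?_ e) hx).trans hvw
    exact (hD.clm_apply continuousOn_const).clm_apply continuousOn_const
  have hgn : ∀ x ∈ T, ‖g x‖ ≤ 4 * c := fun x hx =>
    (opNorm_le_of_dirs _ (first _ h1 x hx) (first _ h2 x hx)).trans (by linarith)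
  have hDn : ∀ x ∈ T, ‖fderivWithin ℝ g T x‖ ≤ 4 * c := by
    intro x hx
    have hsym : IsSymmSndFDerivWithinAt ℝ f T x := by
      refine (hf x hx).isSymmSndFDerivWithinAt (by simp) hu ?_ hx
      rw [hconv.closure_interior_eq_closure_of_nonempty_interior hint]
      exact subset_closure hx
    have hm : ‖fderivWithin ℝ g T x dir1 dir2‖ ≤ c := by
      rw [hsym dir1 dir2]
      exact second _ _ h21 x hx
    refine (opNorm_le_of_dirs _ (opNorm_le_of_dirs _ (second _ _ h11 x hx) hm)
      (opNorm_le_of_dirs _ (second _ _ h21 x hx) (second _ _ h22 x hx))).trans (by linarith)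
  have hfd : ∀ x ∈ T, HasFDerivWithinAt f (g x) T x := fun x hx =>
    (hf.differentiableOn (by norm_num) x hx).hasFDerivWithinAt
  have hglip : ∀ x ∈ T, ∀ y ∈ T, ‖g x - g y‖ ≤ 4 * c * ‖x - y‖ := fun x hx y hy =>
    hconv.norm_image_sub_le_of_norm_fderivWithin_le hgd hDn hy hx
  refine ⟨hgn, hglip, fun x hx y hy =>
    hconv.norm_image_sub_le_of_norm_hasFDerivWithin_le hfd hgn hy hx, fun x hx y hy => ?_⟩
  have hseg : segment ℝ x y ⊆ T := hconv.segment_subset hx hy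
  have := (convex_segment x y).norm_image_sub_le_of_norm_hasFDerivWithin_le' (f := f)
    (φ := g x) (C := 4 * c * ‖y - x‖) (fun z hz => (hfd z (hseg hz)).mono hseg) ?_
    (left_mem_segment ℝ x y) (right_mem_segment ℝ x y)
  · rw [Real.norm_eq_abs] at this
    exact this.trans (le_of_eq (by ring))
  · intro z hz
    refine (hglip z (hseg hz) x hx).trans ?_
    gcongr
    obtain ⟨a, b, ha, hb, hab, rfl⟩ := hz
    have e : a • x + b • y - x = b • (y - x) := by
      have : a = 1 - b := by linarith
      subst this
      module
    rw [e, norm_smul, Real.norm_eq_abs, abs_of_nonneg hb]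
    exact mul_le_of_le_one_left (norm_nonneg _) (by linarith)

end SecondOrder

section Digits

theorem digit_eq_zero {h l : ℕ} (hl : h < 2 ^ l) : digit h l = 0 := by
  simp [digit, Nat.testBit_lt_two_pow hl]

theorem digit_xor_two_pow (h l i : ℕ) :
    digit (h ^^^ 2 ^ l) i = digit h i + if i = l then 1 else 0 := by
  unfold digit
  rw [Nat.testBit_xor, Nat.testBit_two_pow]
  by_cases hil : l = i
  · subst hil
    cases h.testBit l <;> simp
    decide
  · simp [hil, Ne.symm hil]

theorem Xent_eq (Cm : Fin 2 → ℕ → ℕ → F2) {h M : ℕ} (hM : h < 2 ^ M) (i : ℕ) (j : Fin 2) :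
    Xent Cm h i j = ∑ l ∈ Finset.range M, Cm j i l * digit h l := by
  have key : ∀ {M M' : ℕ}, h < 2 ^ M → M ≤ M' → ∑ l ∈ Finset.range M, Cm j i l * digit h l =
      ∑ l ∈ Finset.range M', Cm j i l * digit h l := by
    intro M M' hM hMM
    refine Finset.sum_subset (Finset.range_mono hMM) fun l _ hl => ?_
    rw [digit_eq_zero, mul_zero]
    exact hM.trans_le (Nat.pow_le_pow_right two_pos (by simpa using hl))
  have h1 : h < 2 ^ (h + 1) := Nat.lt_two_pow_self.trans (Nat.pow_lt_pow_succ one_lt_two)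
  exact (key h1 (le_max_left _ M)).trans (key hM (le_max_right _ _)).symm

theorem XrowS_xor_two_pow (Cm : Fin 2 → ℕ → ℕ → F2) (h l i : ℕ) :
    XrowS Cm (h ^^^ 2 ^ l) i = XrowS Cm h i + (Cm 0 i l, Cm 1 i l) := by
  have key : ∀ j, Xent Cm (h ^^^ 2 ^ l) i j = Xent Cm h i j + Cm j i l := by
    intro j
    set M := h + l + 1
    have h1 : h < 2 ^ M := Nat.lt_two_pow_self.trans_le (Nat.pow_le_pow_right two_pos (by omega))
    have h2 : 2 ^ l < 2 ^ M := Nat.pow_lt_pow_right one_lt_two (by omega)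
    rw [Xent_eq Cm h1, Xent_eq Cm (Nat.xor_lt_two_pow h1 h2)]
    simp only [digit_xor_two_pow, mul_add, Finset.sum_add_distrib]
    congr 1
    rw [Finset.sum_eq_single_of_mem l (Finset.mem_range.2 (by omega))]
    · simp
    · intro b _ hb
      simp [hb]
  simp [XrowS, key]

/-- The dyadic block of the `2 ^ m` indices whose quotient by `2 ^ m` is `a`. -/
def dyadicBlock (a m : ℕ) : Finset ℕ := Finset.Ico (a * 2 ^ m) ((a + 1) * 2 ^ m)

theorem mem_dyadicBlock {a m h : ℕ} : h ∈ dyadicBlock a m ↔ h / 2 ^ m = a := by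
  rw [dyadicBlock, Finset.mem_Ico, Nat.div_eq_iff (by positivity)]
  have : 0 < 2 ^ m := by positivity
  rw [add_mul]
  omega

theorem card_dyadicBlock (a m : ℕ) : (dyadicBlock a m).card = 2 ^ m := by
  simp [dyadicBlock, add_mul]

theorem xor_mem_dyadicBlock {a m h l : ℕ} (hl : l < m) (hh : h ∈ dyadicBlock a m) :
    h ^^^ 2 ^ l ∈ dyadicBlock a m := by
  rw [mem_dyadicBlock] at hh ⊢
  rw [Nat.xor_div_two_pow, hh, Nat.div_eq_of_lt (Nat.pow_lt_pow_right one_lt_two hl), Nat.xor_zero]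

/-- The first `n` rows of `X(h)`. -/
def rows (Cm : Fin 2 → ℕ → ℕ → F2) (n h : ℕ) : Fin n → F2 × F2 := fun i => XrowS Cm h i

/-- `K` annihilates the first `m` columns of the generating matrices. -/
def InDual (Cm : Fin 2 → ℕ → ℕ → F2) (m : ℕ) {n : ℕ} (K : Fin n → F2 × F2) : Prop :=
  ∀ l < m, ∑ i : Fin n, (Cm 0 (i : ℕ) l * (K i).1 + Cm 1 (i : ℕ) l * (K i).2) = 0

theorem sum_wal_rows_eq_zero {Cm : Fin 2 → ℕ → ℕ → F2} {m n : ℕ} {K : Fin n → F2 × F2}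
    (hK : ¬ InDual Cm m K) (a : ℕ) : ∑ h ∈ dyadicBlock a m, wal K (rows Cm n h) = 0 := by
  simp only [InDual, not_forall] at hK
  obtain ⟨l, hl, hne⟩ := hK
  have hw : wal K (fun i => (Cm 0 i l, Cm 1 i l)) = -1 := by
    have h1 : ∑ i : Fin n, ((K i).1 * Cm 0 i l + (K i).2 * Cm 1 i l) = 1 := by
      rw [← (F2_cases _).resolve_left hne]
      simp only [mul_comm]
    rw [wal_eq, h1, ZMod.val_one, pow_one]
  have h1 : ∑ h ∈ dyadicBlock a m, wal K (rows Cm n h) =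
      ∑ h ∈ dyadicBlock a m, wal K (rows Cm n (h ^^^ 2 ^ l)) :=
    (Finset.sum_nbij' (· ^^^ 2 ^ l) (· ^^^ 2 ^ l) (fun _ => xor_mem_dyadicBlock hl)
      (fun _ => xor_mem_dyadicBlock hl) (by simp) (by simp) (by simp)).symm
  have h2 : ∀ h, wal K (rows Cm n (h ^^^ 2 ^ l)) = -wal K (rows Cm n h) := by
    intro h
    have : rows Cm n (h ^^^ 2 ^ l) = rows Cm n h + (fun i : Fin n => (Cm 0 i l, Cm 1 i l)) := by
      funext i
      exact XrowS_xor_two_pow Cm h l i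
    rw [this, wal_add_right, hw, mul_neg_one]
  simp only [h2, Finset.sum_neg_distrib] at h1
  linarith

theorem abs_sum_wal_rows_le (Cm : Fin 2 → ℕ → ℕ → F2) (m : ℕ) {n : ℕ} (K : Fin n → F2 × F2)
    (a : ℕ) : |∑ h ∈ dyadicBlock a m, wal K (rows Cm n h)| ≤ 2 ^ m := by
  refine (Finset.abs_sum_le_sum_abs _ _).trans (le_of_eq ?_)
  simp [abs_wal, card_dyadicBlock]

theorem XrowS_eq_zero {Cm : Fin 2 → ℕ → ℕ → F2}
    (htri : ∀ j : Fin 2, ∀ k l : ℕ, l < k → Cm j k l = 0) {h i : ℕ} (hi : h < i) :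
    XrowS Cm h i = (0, 0) := by
  have : ∀ j, Xent Cm h i j = 0 := fun j => Finset.sum_eq_zero fun l hl => by
    rw [htri j i l (by rw [Finset.mem_range] at hl; omega), zero_mul]
  simp [XrowS, this]

theorem XrowS_eq_zero_of_nuF_le {Cm : Fin 2 → ℕ → ℕ → F2}
    (htri : ∀ j : Fin 2, ∀ k l : ℕ, l < k → Cm j k l = 0) {h i : ℕ} (hi : nuF Cm h ≤ i) :
    XrowS Cm h i = (0, 0) :=
  (Nat.sInf_mem (s := {q | ∀ i, q ≤ i → XrowS Cm h i = (0, 0)})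
    ⟨h + 1, fun _ hi => XrowS_eq_zero htri hi⟩) i hi

theorem seqPt_eq_ctr_rows {Cm : Fin 2 → ℕ → ℕ → F2}
    (htri : ∀ j : Fin 2, ∀ k l : ℕ, l < k → Cm j k l = 0) (v : Pt × Pt × Pt) {h n : ℕ}
    (hn : nuF Cm h ≤ n) : seqPt v Cm h = ctr v (List.ofFn (rows Cm n h)) := by
  induction n, hn using Nat.le_induction with
  | base => rfl
  | succ n hn ih =>
    rw [ih, List.ofFn_succ', List.concat_eq_append, ctr_eq, ctr_eq v (_ ++ _), vIter_concat]
    have : rows Cm (n + 1) h (Fin.last n) = (0, 0) := XrowS_eq_zero_of_nuF_le htri hn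
    rw [this, ctr_subV_zero]
    rfl

theorem ofFn_rows_add (Cm : Fin 2 → ℕ → ℕ → F2) (h n k : ℕ) :
    ∃ l, List.ofFn (rows Cm (n + k) h) = List.ofFn (rows Cm n h) ++ l :=
  ⟨_, List.ofFn_add⟩

theorem seqPt_mem {Cm : Fin 2 → ℕ → ℕ → F2}
    (htri : ∀ j : Fin 2, ∀ k l : ℕ, l < k → Cm j k l = 0) (v : Pt × Pt × Pt) (h n : ℕ) :
    seqPt v Cm h ∈ subTri v (List.ofFn (rows Cm n h)) := by
  rw [seqPt_eq_ctr_rows htri v (Nat.le_add_left (nuF Cm h) n)]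
  obtain ⟨l, hl⟩ := ofFn_rows_add Cm h n (nuF Cm h)
  have := ctr_mem v (List.ofFn (rows Cm (n + nuF Cm h) h))
  rw [hl] at this ⊢
  exact subTri_append_subset v _ l this

theorem norm_seqPt_sub_ctr_le {Cm : Fin 2 → ℕ → ℕ → F2}
    (htri : ∀ j : Fin 2, ∀ k l : ℕ, l < k → Cm j k l = 0) (v : Pt × Pt × Pt) (h n : ℕ) :
    ‖seqPt v Cm h - ctr v (List.ofFn (rows Cm n h))‖ ≤ perim v / 2 ^ n := by
  refine (norm_sub_ctr_le (v := vIter v (List.ofFn (rows Cm n h)))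
    (seqPt_mem htri v h n)).trans (le_of_eq ?_)
  rw [perim_vIter, List.length_ofFn]

end Digits

section Dual

/-- The generating matrices define a digital `(t, m, 2)`-net for all `m > t` and all numbers
`n ≥ m` of rows. -/
def IsDigitalSeq (t : ℕ) (Cm : Fin 2 → ℕ → ℕ → F2) : Prop :=
  ∀ m n : ℕ, t < m → m ≤ n → ∀ K : Fin n → F2 × F2, K ≠ 0 → InDual Cm m K →
    m - t + 1 ≤ mu1 (fun i => (K i).1) + mu1 (fun i => (K i).2)

theorem mu1_le {n u : ℕ} {k : Fin n → F2} (h : ∀ i : Fin n, u ≤ i → k i = 0) : mu1 k ≤ u := by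
  refine Finset.sup_le fun i hi => ?_
  by_contra hlt
  exact (Finset.mem_filter.1 hi).2 (h i (by omega))

theorem eq_zero_of_inDual {t : ℕ} {Cm : Fin 2 → ℕ → ℕ → F2} (hseq : IsDigitalSeq t Cm)
    {m n u : ℕ} (hn : n ≤ m) (hu : u ≤ (m - t) / 2) {K : Fin n → F2 × F2} (hK : InDual Cm m K)
    (hz : ∀ i : Fin n, u ≤ i → K i = 0) : K = 0 := by
  by_contra hne
  have hu0 : u ≠ 0 := by
    rintro rfl
    exact hne (funext fun i => hz i (Nat.zero_le _))
  obtain ⟨k, rfl⟩ := Nat.exists_eq_add_of_le hn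
  set K' : Fin (n + k) → F2 × F2 := Fin.append K 0
  have hz' : ∀ i : Fin (n + k), u ≤ i → K' i = 0 := by
    intro i
    refine Fin.addCases (fun i hi => ?_) (fun i _ => ?_) i
    · simpa [K'] using hz i hi
    · simp [K']
  have hK' : InDual Cm (n + k) K' := by
    intro l hl
    rw [Fin.sum_univ_add]
    simpa [K'] using hK l hl
  have hne' : K' ≠ 0 := fun h => hne (funext fun i => by
    simpa [K'] using congrFun h (Fin.castAdd k i))
  have h1 := hseq (n + k) (n + k) (by omega) le_rfl K' hne' hK'
  have h2 : mu1 (fun i => (K' i).1) ≤ u := mu1_le fun i hi => by simp [hz' i hi]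
  have h3 : mu1 (fun i => (K' i).2) ≤ u := mu1_le fun i hi => by simp [hz' i hi]
  omega

open Classical in
theorem card_dual_le {t : ℕ} {Cm : Fin 2 → ℕ → ℕ → F2} (hseq : IsDigitalSeq t Cm)
    {m n u : ℕ} (hn : n ≤ m) (hu : u ≤ (m - t) / 2) :
    (Finset.univ.filter fun K : Fin n → F2 × F2 => InDual Cm m K).card ≤ 4 ^ (n - u) := by
  rw [← card_rows (n - u), ← Finset.card_univ]
  refine Finset.card_le_card_of_injOn
    (fun K (i : Fin (n - u)) => K ⟨u + i, by omega⟩) (fun _ _ => Finset.mem_univ _) ?_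
  intro K hK K' hK' h
  rw [Finset.mem_coe, Finset.mem_filter] at hK hK'
  have hadd : K + K' = 0 := by
    refine eq_zero_of_inDual hseq hn hu (fun l hl => ?_) fun i hi => ?_
    · have h1 := congrArg₂ (· + ·) (hK.2 l hl) (hK'.2 l hl)
      simp only [← Finset.sum_add_distrib, add_zero] at h1
      rw [← h1]
      refine Finset.sum_congr rfl fun i _ => ?_
      simp only [Pi.add_apply, Prod.fst_add, Prod.snd_add]
      ring
    · have := congrFun h ⟨i - u, by omega⟩
      simp only [Nat.add_sub_cancel' hi] at this
      exact (F2_prod_add_eq_zero _ _).2 this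
  exact funext fun i => (F2_prod_add_eq_zero _ _).1 (congrFun hadd i)

theorem abs_sum_block_le {t : ℕ} {Cm : Fin 2 → ℕ → ℕ → F2} (hseq : IsDigitalSeq t Cm)
    {m n : ℕ} (hn : n ≤ m) {G : (Fin n → F2 × F2) → ℝ} (hG : ∑ X, G X = 0) {β : ℝ}
    (hβ : ∀ K, |∑ X, G X * wal K X| ≤ β) (a : ℕ) :
    |∑ h ∈ dyadicBlock a m, G (rows Cm n h)| ≤ 2 ^ (t + 1) * β := by
  classical
  have hβ0 : 0 ≤ β := (abs_nonneg _).trans (hβ 0)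
  set u := (m - t) / 2 with hu
  set S : (Fin n → F2 × F2) → ℝ := fun K => ∑ h ∈ dyadicBlock a m, wal K (rows Cm n h)
  have hS : ∀ K, ¬ InDual Cm m K → S K = 0 := fun K hK => sum_wal_rows_eq_zero hK a
  have e : 4 ^ n * ∑ h ∈ dyadicBlock a m, G (rows Cm n h) =
      ∑ K, (∑ X, G X * wal K X) * S K := by
    simp only [S, Finset.mul_sum, walsh_inversion]
    exact Finset.sum_comm
  have h0 : ∑ X, G X * wal (0 : Fin n → F2 × F2) X = 0 := by
    rw [← hG]
    refine Finset.sum_congr rfl fun X _ => ?_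
    have : wal 0 X = 1 := Finset.prod_eq_one fun i _ => walRow_zero_left _
    rw [this, mul_one]
  rcases le_or_gt n u with hnu | hnu
  · have hz : ∑ K, (∑ X, G X * wal K X) * S K = 0 := by
      refine Finset.sum_eq_zero fun K _ => ?_
      by_cases hK : InDual Cm m K
      · rw [eq_zero_of_inDual hseq hn le_rfl hK fun i hi => by omega, h0, zero_mul]
      · rw [hS K hK, mul_zero]
    rw [hz] at e
    rw [(mul_eq_zero.1 e).resolve_left (by positivity), abs_zero]
    positivity
  · have h1 : |4 ^ n * ∑ h ∈ dyadicBlock a m, G (rows Cm n h)| ≤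
        4 ^ (n - u) * (β * 2 ^ m) := by
      rw [e, ← Finset.sum_filter_of_ne (p := fun K => InDual Cm m K)]
      · refine (Finset.abs_sum_le_sum_abs _ _).trans ?_
        refine (Finset.sum_le_card_nsmul _ _ (β * 2 ^ m) fun K _ => ?_).trans ?_
        · rw [abs_mul]
          exact mul_le_mul (hβ K) (abs_sum_wal_rows_le Cm m K a) (abs_nonneg _) hβ0
        · rw [nsmul_eq_mul]
          gcongr
          exact_mod_cast card_dual_le hseq hn le_rfl
      · intro K _ hne
        by_contra hK
        exact hne (by rw [hS K hK, mul_zero])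
    rw [abs_mul, abs_of_pos (by positivity : (0:ℝ) < 4 ^ n)] at h1
    have h2 : (2:ℝ) ^ m ≤ 4 ^ u * 2 ^ (t + 1) := by
      rw [show (4:ℝ) = 2 ^ 2 by norm_num, ← pow_mul, ← pow_add]
      exact pow_le_pow_right₀ one_le_two (by omega)
    have h3 : (4:ℝ) ^ (n - u) * (β * 2 ^ m) ≤ 4 ^ n * (2 ^ (t + 1) * β) := by
      calc (4:ℝ) ^ (n - u) * (β * 2 ^ m) ≤ 4 ^ (n - u) * (β * (4 ^ u * 2 ^ (t + 1))) := by gcongr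
        _ = 4 ^ (n - u + u) * (2 ^ (t + 1) * β) := by rw [pow_add]; ring
        _ = _ := by rw [Nat.sub_add_cancel hnu.le]
    exact le_of_mul_le_mul_left (h1.trans h3) (by positivity)

end Dual

section Discrepancy

theorem sum_levelDiff_rows (φ : Pt → ℝ) (v : Pt × Pt × Pt) (Cm : Fin 2 → ℕ → ℕ → F2) (m h : ℕ) :
    φ (ctr v (List.ofFn (rows Cm m h))) - lvlAvg φ m v =
      ∑ n ∈ Finset.range m, levelDiff φ v (m - 1 - n) (rows Cm (n + 1) h) := by
  have key := Finset.sum_range_sub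
    (fun n => lvlAvg φ (m - n) (vIter v (List.ofFn (rows Cm n h)))) m
  simp only [Nat.sub_self, Nat.sub_zero, List.ofFn_zero, vIter_nil] at key
  rw [ctr_eq]
  refine key.symm.trans (Finset.sum_congr rfl fun n hn => ?_)
  have h1 : m - (n + 1) = m - 1 - n := by omega
  have h2 : m - n = m - 1 - n + 1 := by rw [Finset.mem_range] at hn; omega
  rw [h1, h2]
  rfl

/-- The factor relating the second-order data of the integrand to the integration error. -/
def blockConst (t : ℕ) (s : ℝ) : ℝ := 2 * s + 2 ^ (t + 1) * (4 * s + 8 * s ^ 2)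

theorem blockConst_nonneg (t : ℕ) {s : ℝ} (hs : 0 ≤ s) : 0 ≤ blockConst t s := by
  unfold blockConst
  positivity

theorem abs_sum_block_error_le {t : ℕ} {Cm : Fin 2 → ℕ → ℕ → F2} (hseq : IsDigitalSeq t Cm)
    (htri : ∀ j : Fin 2, ∀ k l : ℕ, l < k → Cm j k l = 0) {v : Pt × Pt × Pt}
    (hv : (interior (subTri v [])).Nonempty) {φ : Pt → ℝ} {g : Pt → Pt →L[ℝ] ℝ} {Q : ℝ}
    (hφ : ContinuousOn φ (subTri v [])) (h : TaylorBound φ g Q (subTri v [])) (a m : ℕ) :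
    |∑ i ∈ dyadicBlock a m, (φ (seqPt v Cm i) -
      (volume (subTri v [])).toReal⁻¹ * ∫ x in subTri v [], φ x)| ≤
      Q * blockConst t (perim v) * ((m : ℝ) + 1) ^ 2 := by
  have hQ : 0 ≤ Q := (norm_nonneg _).trans (h.norm_le _ (ctr_mem v []))
  set s := perim v with hsdef
  have hs : 0 ≤ s := perim_nonneg v
  set I := (volume (subTri v [])).toReal⁻¹ * ∫ x in subTri v [], φ x with hI
  have hvol : 0 < (volume (subTri v [])).toReal :=
    ENNReal.toReal_pos (Measure.measure_pos_of_nonempty_interior _ hv).ne' (volume_subTri_ne_top v)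
  have hint : |lvlAvg φ m v - I| ≤ Q * s / 2 ^ m := by
    have h1 := abs_integral_sub_lvlAvg_le hQ m v hφ h.lipschitz
    have e : (∫ x in subTri v [], φ x) - (volume (subTri v [])).toReal * lvlAvg φ m v =
        -((volume (subTri v [])).toReal * (lvlAvg φ m v - I)) := by
      rw [hI]
      field_simp
      ring
    rw [e, abs_neg, abs_mul, abs_of_pos hvol] at h1
    exact le_of_mul_le_mul_left h1 hvol
  have hpt : ∀ i, |φ (seqPt v Cm i) - φ (ctr v (List.ofFn (rows Cm m i)))| ≤ Q * s / 2 ^ m := by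
    intro i
    refine (h.lipschitz _ (seqPt_mem htri v i 0) _
      (subTri_append_subset v [] _ (ctr_mem v _))).trans ?_
    rw [mul_div_assoc]
    gcongr
    exact norm_seqPt_sub_ctr_le htri v i m
  have e : ∑ i ∈ dyadicBlock a m, (φ (seqPt v Cm i) - I) =
      (∑ i ∈ dyadicBlock a m, ((φ (seqPt v Cm i) - φ (ctr v (List.ofFn (rows Cm m i)))) +
        (lvlAvg φ m v - I))) +
      ∑ n ∈ Finset.range m,
        ∑ i ∈ dyadicBlock a m, levelDiff φ v (m - 1 - n) (rows Cm (n + 1) i) := by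
    rw [Finset.sum_comm, ← Finset.sum_add_distrib]
    refine Finset.sum_congr rfl fun i _ => ?_
    rw [← sum_levelDiff_rows]
    ring
  have h1 : |∑ i ∈ dyadicBlock a m, ((φ (seqPt v Cm i) - φ (ctr v (List.ofFn (rows Cm m i)))) +
      (lvlAvg φ m v - I))| ≤ 2 * (Q * s) := by
    refine (Finset.abs_sum_le_sum_abs _ _).trans ((Finset.sum_le_card_nsmul _ _
      (2 * (Q * s / 2 ^ m)) fun i _ => ?_).trans (le_of_eq ?_))
    · refine (abs_add_le _ _).trans ?_
      linarith [hpt i]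
    · rw [card_dyadicBlock, nsmul_eq_mul]
      push_cast
      field_simp
  have h2 : |∑ n ∈ Finset.range m,
      ∑ i ∈ dyadicBlock a m, levelDiff φ v (m - 1 - n) (rows Cm (n + 1) i)| ≤
      m * (2 ^ (t + 1) * (4 * Q * s + 8 * m * Q * s ^ 2)) := by
    refine (Finset.abs_sum_le_sum_abs _ _).trans ((Finset.sum_le_card_nsmul _ _
      (2 ^ (t + 1) * (4 * Q * s + 8 * m * Q * s ^ 2)) fun n hn => ?_).trans (le_of_eq ?_))
    · have hn' : n + 1 ≤ m := Finset.mem_range.1 hn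
      refine (abs_sum_block_le hseq hn' (sum_levelDiff φ v _ n)
        (abs_walsh_coefficient_levelDiff_le h _) a).trans ?_
      have hnm : (n : ℝ) + 1 ≤ m := by exact_mod_cast hn'
      have : ((n : ℝ) + 1) * (Q * s ^ 2) ≤ m * (Q * s ^ 2) := by gcongr
      refine mul_le_mul_of_nonneg_left ?_ (by positivity)
      rw [← hsdef]
      linarith
    · rw [Finset.card_range, nsmul_eq_mul]
  rw [e]
  refine (abs_add_le _ _).trans ((add_le_add h1 h2).trans ?_)
  have hm : (0:ℝ) ≤ m := Nat.cast_nonneg m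
  have hp1 : 0 ≤ Q * s * (m ^ 2 + 2 * m) := by positivity
  have hp2 : 0 ≤ 2 ^ (t + 1) * (Q * s * (m ^ 2 + m + 1)) := by positivity
  have hp3 : 0 ≤ 2 ^ (t + 1) * (Q * s ^ 2 * (2 * m + 1)) := by positivity
  unfold blockConst
  linarith

theorem abs_sum_range_le_of_dyadicBlock {e : ℕ → ℝ} {E : ℝ} {L : ℕ}
    (hE : ∀ a m, m < L → |∑ i ∈ dyadicBlock a m, e i| ≤ E) (M : ℕ) :
    ∀ k a, k + M ≤ L → a < 2 ^ M → |∑ i ∈ Finset.range (a * 2 ^ k), e i| ≤ M * E := by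
  induction M with
  | zero =>
    intro k a _ ha
    obtain rfl : a = 0 := by simpa using ha
    simp
  | succ M ih =>
    intro k a hk ha
    have hE0 : 0 ≤ E := (abs_nonneg _).trans (hE 0 k (by omega))
    have h1 := ih (k + 1) (a / 2) (by omega) (by rw [pow_succ] at ha; omega)
    push_cast
    rw [add_mul, one_mul]
    rcases Nat.even_or_odd' a with ⟨b, rfl | rfl⟩
    · rw [Nat.mul_div_cancel_left _ two_pos, pow_succ, mul_comm _ 2, ← mul_assoc,
        mul_comm b] at h1
      linarith
    · rw [show (2 * b + 1) / 2 = b by omega, pow_succ, mul_comm _ 2, ← mul_assoc, mul_comm b] at h1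
      have h2 := hE (2 * b) k (by omega)
      have h3 := Finset.sum_range_add_sum_Ico e
        (show 2 * b * 2 ^ k ≤ (2 * b + 1) * 2 ^ k by gcongr; omega)
      rw [← h3]
      exact (abs_add_le _ _).trans (add_le_add h1 h2)

theorem natLog_add_one_le_two_mul_logb {N : ℕ} (hN : 2 ≤ N) :
    ((Nat.log 2 N + 1 : ℕ) : ℝ) ≤ 2 * Real.logb 2 N := by
  have h1 : (Nat.log 2 N : ℝ) ≤ Real.logb 2 N := by exact_mod_cast Real.natLog_le_logb N 2
  have h2 : (1:ℝ) ≤ Real.logb 2 N := by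
    rw [Real.le_logb_iff_rpow_le one_lt_two (by positivity), Real.rpow_one]
    exact_mod_cast hN
  push_cast
  linarith

theorem abs_average_sub_integral_le {t : ℕ} {Cm : Fin 2 → ℕ → ℕ → F2} (hseq : IsDigitalSeq t Cm)
    (htri : ∀ j : Fin 2, ∀ k l : ℕ, l < k → Cm j k l = 0) {v : Pt × Pt × Pt}
    (hv : (interior (subTri v [])).Nonempty) {φ : Pt → ℝ} {g : Pt → Pt →L[ℝ] ℝ} {Q : ℝ}
    (hφ : ContinuousOn φ (subTri v [])) (h : TaylorBound φ g Q (subTri v [])) {N : ℕ}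
    (hN : 2 ≤ N) :
    |(N : ℝ)⁻¹ * ∑ i ∈ Finset.range N, φ (seqPt v Cm i) -
      (volume (subTri v [])).toReal⁻¹ * ∫ x in subTri v [], φ x| ≤
      8 * blockConst t (perim v) * Q * Real.logb 2 N ^ 3 / N := by
  have hQ : 0 ≤ Q := (norm_nonneg _).trans (h.norm_le _ (ctr_mem v []))
  have hκ := blockConst_nonneg t (perim_nonneg v)
  set κ := blockConst t (perim v)
  set I := (volume (subTri v [])).toReal⁻¹ * ∫ x in subTri v [], φ x with hI
  set L := Nat.log 2 N + 1 with hL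
  have hsum := abs_sum_range_le_of_dyadicBlock (e := fun i => φ (seqPt v Cm i) - I)
    (E := Q * κ * (L : ℝ) ^ 2) (L := L) (fun a m hm => by
      refine (abs_sum_block_error_le hseq htri hv hφ h a m).trans ?_
      gcongr
      exact_mod_cast hm) L 0 N (by simp) (Nat.lt_pow_succ_log_self one_lt_two N)
  rw [pow_zero, mul_one, Finset.sum_sub_distrib, Finset.sum_const, Finset.card_range,
    nsmul_eq_mul] at hsum
  have hN0 : (0:ℝ) < N := by positivity
  have e : (N : ℝ)⁻¹ * ∑ i ∈ Finset.range N, φ (seqPt v Cm i) - I =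
      (∑ i ∈ Finset.range N, φ (seqPt v Cm i) - N * I) / N := by
    field_simp
  rw [e, abs_div, abs_of_pos hN0]
  gcongr
  refine hsum.trans ?_
  calc (L : ℝ) * (Q * κ * (L : ℝ) ^ 2) = Q * κ * (L : ℝ) ^ 3 := by ring
    _ ≤ Q * κ * (2 * Real.logb 2 N) ^ 3 := by
      gcongr
      exact natLog_add_one_le_two_mul_logb hN
    _ = _ := by ring

end Discrepancy

/-- Worst-case error bound `C ‖f‖_{C²(T)} (log₂ N)³ / N` for the QMC rule
in a triangle generated by a digital `(t,2)`-sequence with upper triangular generating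
matrices. -/
theorem statement1 (A B C : Pt) (hT : AffineIndependent ℝ ![A, B, C]) (t : ℕ)
    (Cm : Fin 2 → ℕ → ℕ → F2)
    (htri : ∀ j : Fin 2, ∀ k l : ℕ, l < k → Cm j k l = 0)
    (hseq : ∀ m n : ℕ, t < m → m ≤ n → ∀ K : Fin n → F2 × F2, K ≠ 0 →
      (∀ l : ℕ, l < m →
        (∑ i : Fin n, (Cm 0 (i : ℕ) l * (K i).1 + Cm 1 (i : ℕ) l * (K i).2)) = 0) →
      m - t + 1 ≤ mu1 (fun i => (K i).1) + mu1 (fun i => (K i).2)) :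
    ∃ Cc : ℝ, 0 < Cc ∧
      ∀ f : Pt → ℝ, ContDiffOn ℝ 2 f (tri A B C) →
        ∀ N : ℕ, 2 ≤ N →
          |(N : ℝ)⁻¹ * ∑ h ∈ Finset.range N, f (seqPt (A, B, C) Cm h) -
            (volume (tri A B C)).toReal⁻¹ * ∫ z in tri A B C, f z| ≤
          Cc * c2Norm (tri A B C) f * (Real.logb 2 N) ^ 3 / N := by
  have hv := interior_subTri_nonempty hT
  have hκ := blockConst_nonneg t (perim_nonneg (A, B, C))
  refine ⟨32 * blockConst t (perim (A, B, C)) + 1, by positivity, fun f hf N hN => ?_⟩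
  have hTB := taylorBound_of_contDiffOn (isCompact_subTri (A, B, C)) (convex_subTri _) hv hf
  refine (abs_average_sub_integral_le hseq htri hv hf.continuousOn hTB hN).trans ?_
  have hc : 0 ≤ c2Norm (subTri (A, B, C) []) f := c2Norm_nonneg _ f
  have hlog : 0 ≤ Real.logb 2 N :=
    Real.logb_nonneg one_lt_two (by exact_mod_cast (show 1 ≤ N by omega))
  change _ ≤ _ * c2Norm (subTri (A, B, C) []) f * _ / _
  have hp : 0 ≤ c2Norm (subTri (A, B, C) []) f * Real.logb 2 N ^ 3 := by positivity
  gcongr ?_ / _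
  linarith
end
end
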